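/- Let N ≥ 1 be an integer, k an integer, χ a Dirichlet character modulo N with values in ℂ, and ℓ a prime not dividing N. Let V be a finite-dimensional ℂ-subspace of ℂ((q)) such that every element of V is a weight-k modular ratio of character χ for level N, and suppose that V is stable under the Hecke operator T on q-expansions, i.e. T(V) ⊆ V. Then every element of V is the q-expansion of a modular form of weight k, level N and nebentypus χ. (Characteristic-zero case of the Hecke stability theorem.) -/

import Mathlib

open UpperHalfPlane CongruenceSubgroup Function
open scoped ModularForm MatrixGroups

noncomputable section

/-- `f` has nebentypus `ψ` in weight `k`: `f ∣[k] γ = ψ(d) • f` for all `γ = (a b; c d)` in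
`Γ₀(N)`. -/
def HasNeben {N : ℕ} (k : ℤ) (ψ : DirichletCharacter ℂ N) (f : ℍ → ℂ) : Prop :=
  ∀ γ : SL(2, ℤ), γ ∈ Gamma0 N → f ∣[k] γ = ψ ((γ 1 1 : ℤ) : ZMod N) • f

/-- The `q`-expansion of a `1`-periodic function on the upper half-plane, as a formal power
series: its coefficients are the Taylor coefficients at `q = 0` of the associated cusp
function `F` (with `f τ = F (e^{2πiτ})`). -/
def qExpansionPS (f : ℍ → ℂ) : PowerSeries ℂ :=
  PowerSeries.mk fun n =>
    iteratedDeriv n (Function.Periodic.cuspFunction 1 (f ∘ ofComplex)) 0 / n.factorial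

/-- The `q`-expansion, regarded as a formal Laurent series in `ℂ((q))`. -/
def qExpansionL (f : ℍ → ℂ) : LaurentSeries ℂ :=
  HahnSeries.ofPowerSeries ℤ ℂ (qExpansionPS f)

/-- `h ∈ ℂ((q))` is a weight-`k` modular ratio of character `χ` for level `N`: there are a
weight `w ≥ 0`, a Dirichlet character `ψ` mod `N`, a nonzero modular form `G` of weight `w`,
level `N` and nebentypus `ψ`, and a modular form `F` of weight `w + k`, level `N` and
nebentypus `χψ`, with `qexp F = h · qexp G` in `ℂ((q))`. -/
def IsModularRatio (N : ℕ) (k : ℤ) (χ : DirichletCharacter ℂ N)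
    (h : LaurentSeries ℂ) : Prop :=
  ∃ (w : ℤ) (_ : 0 ≤ w) (ψ : DirichletCharacter ℂ N)
    (G : ModularForm (Gamma1 N) w) (F : ModularForm (Gamma1 N) (w + k)),
      G ≠ 0 ∧ HasNeben w ψ ⇑G ∧ HasNeben (w + k) (χ * ψ) ⇑F ∧
        qExpansionL ⇑F = h * qExpansionL ⇑G

/-- The graph of the Hecke operator `T` on `q`-expansions:
`T(∑ₙ aₙ qⁿ) = ∑ₙ a_{ℓn} qⁿ + c · ∑ₙ aₙ q^{ℓn}`. -/
def IsHeckeT (ℓ : ℕ) (c : ℂ) (f g : LaurentSeries ℂ) : Prop :=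
  ∀ n : ℤ, g.coeff n =
    f.coeff (ℓ * n) + c * (if (ℓ : ℤ) ∣ n then f.coeff (n / ℓ) else 0)

section HeckeStability

open scoped Manifold

lemma padicValInt_le_of_mul_eq_mul {p : ℕ} [Fact p.Prime] {s t x y : ℤ} (hs : s ≠ 0)
    (hx : ¬ (p : ℤ) ∣ x) (h : s * x = t * y) : padicValInt p t ≤ padicValInt p s := by
  have hx0 : x ≠ 0 := by rintro rfl; simp at hx
  have hty : t * y ≠ 0 := h ▸ mul_ne_zero hs hx0
  have h1 := congrArg (padicValInt p) h
  rw [padicValInt.mul hs hx0, padicValInt.mul (left_ne_zero_of_mul hty) (right_ne_zero_of_mul hty),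
    padicValInt.eq_zero_of_not_dvd hx] at h1
  omega

lemma padicValInt_lt_of_eq_pow_mul {p : ℕ} [hp : Fact p.Prime] {x y : ℤ} (e : ℕ) (he : e ≠ 0)
    (hx : x ≠ 0) (h : y = (p : ℤ) ^ e * x) : padicValInt p x < padicValInt p y := by
  have hp0 : (p : ℤ) ≠ 0 := by exact_mod_cast hp.out.ne_zero
  rw [h, padicValInt.mul (pow_ne_zero _ hp0) hx, ← Nat.cast_pow, padicValInt.of_nat,
    padicValNat.prime_pow]
  omega

/-- A relation assigning heights to points of the upper half-plane which is invariant under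
`SL(2, ℤ)` and for which every point has an `ℓ`-neighbour all of whose other `ℓ`-neighbours
are strictly higher than the given point. -/
structure IsHeight (ℓ : ℕ) (R : ℂ → ℕ → Prop) : Prop where
  smul : ∀ (γ : SL(2, ℤ)) (τ : ℍ) (n : ℕ), R τ n → R (γ • τ : ℍ) n
  unique : ∀ (z : ℂ) (m n : ℕ), 0 < z.im → R z m → R z n → m = n
  step : ∀ (z : ℂ) (n : ℕ), 0 < z.im → R z n →
    ((∃ m > n, R (ℓ * z) m) ∧ (∃ m > n, R (ℓ * (ℓ * z)) m) ∧
      ∀ j : ℕ, 0 < j → j < ℓ → ∃ m > n, R (z + j / ℓ) m) ∨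
    ∃ j : ℤ, (∃ m > n, R ((z + j) / ℓ) m) ∧
      ∀ i : ℕ, i < ℓ → ∃ m > n, R (((z + j) / ℓ + i) / ℓ) m

lemma coe_smul_mul_denom (γ : SL(2, ℤ)) (τ : ℍ) :
    ((γ • τ : ℍ) : ℂ) * ((γ 1 0 : ℤ) * (τ : ℂ) + (γ 1 1 : ℤ)) =
      (γ 0 0 : ℤ) * (τ : ℂ) + (γ 0 1 : ℤ) := by
  rw [UpperHalfPlane.specialLinearGroup_apply]
  have := UpperHalfPlane.denom_ne_zero (γ : GL (Fin 2) ℝ) τ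
  simp only [UpperHalfPlane.denom] at this
  simp at this ⊢
  rw [div_mul_cancel₀]
  simpa using this

lemma int_combo_eq_zero {z : ℂ} (hz : 0 < z.im) {a b : ℤ} (h : (a : ℂ) * z + b = 0) :
    a = 0 ∧ b = 0 := by
  have h1 := congrArg Complex.im h
  have h2 := congrArg Complex.re h
  simp at h1 h2
  have ha : a = 0 := by rcases h1 with h | h; exact h; linarith
  subst ha
  simpa using h2

/-- Height of a quadratic irrationality: the `ℓ`-adic valuation of its discriminant. -/
def quadHeight (ℓ : ℕ) (z : ℂ) (n : ℕ) : Prop :=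
  ∃ a b c : ℤ, ¬ ((ℓ : ℤ) ∣ a ∧ (ℓ : ℤ) ∣ b ∧ (ℓ : ℤ) ∣ c) ∧
    (a : ℂ) * z ^ 2 + b * z + c = 0 ∧ n = padicValInt ℓ (b ^ 2 - 4 * a * c)

lemma quad_disc_neg {z : ℂ} (hz : 0 < z.im) {a b c : ℤ} (h : (a : ℂ) * z ^ 2 + b * z + c = 0)
    (h0 : ¬ (a = 0 ∧ b = 0 ∧ c = 0)) : a ≠ 0 ∧ b ^ 2 - 4 * a * c ≠ 0 := by
  have ha : a ≠ 0 := by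
    rintro rfl
    have := int_combo_eq_zero (a := b) (b := c) hz (by simpa using h)
    tauto
  refine ⟨ha, fun hD ↦ ?_⟩
  have h1 := congrArg Complex.im h
  have h2 := congrArg Complex.re h
  simp [pow_two] at h1 h2
  have hD' : (b : ℝ) ^ 2 - 4 * a * c = 0 := by exact_mod_cast hD
  have ha' : (a : ℝ) ≠ 0 := by exact_mod_cast ha
  have h3 : 2 * a * z.re + b = 0 := by
    have : z.im * (2 * a * z.re + b) = 0 := by linarith
    rcases mul_eq_zero.mp this with h | h
    · linarith
    · exact h
  have h4 : (a : ℝ) ^ 2 * z.im ^ 2 = 0 := by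
    have hb : (b : ℝ) = -2 * a * z.re := by linarith
    rw [hb] at hD' h2
    linear_combination (-(a : ℝ)) * h2 - hD' / 4
  have : 0 < (a : ℝ) ^ 2 * z.im ^ 2 := by positivity
  linarith

lemma isHeight_quad {ℓ : ℕ} [hp : Fact ℓ.Prime] : IsHeight ℓ (quadHeight ℓ) := by
  have hℓ : Prime (ℓ : ℤ) := Nat.prime_iff_prime_int.mp hp.out
  have hℓ0 : (ℓ : ℂ) ≠ 0 := by exact_mod_cast hp.out.ne_zero
  refine ⟨?_, ?_, ?_⟩
  · rintro γ τ n ⟨a, b, c, hprim, heq, rfl⟩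
    have hdet := Matrix.SpecialLinearGroup.det_coe γ
    rw [Matrix.det_fin_two] at hdet
    have hm := coe_smul_mul_denom γ τ
    set z := ((γ • τ : ℍ) : ℂ)
    set t := (τ : ℂ)
    set p := γ 0 0
    set q := γ 0 1
    set r := γ 1 0
    set s := γ 1 1
    -- inverse substitution
    have hdetC : (p : ℂ) * s - q * r = 1 := by exact_mod_cast hdet
    have hden : (r : ℂ) * t + s ≠ 0 := by
      intro h0
      have h1 := int_combo_eq_zero τ.im_pos h0
      simp [h1.1, h1.2] at hdet
    refine ⟨a * s ^ 2 - b * r * s + c * r ^ 2,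
      -2 * a * q * s + b * (p * s + q * r) - 2 * c * p * r,
      a * q ^ 2 - b * p * q + c * p ^ 2, ?_, ?_, ?_⟩
    · rintro ⟨⟨x, hx⟩, ⟨y, hy⟩, ⟨w, hw⟩⟩
      refine hprim ⟨⟨p ^ 2 * x + p * r * y + r ^ 2 * w, ?_⟩,
        ⟨2 * p * q * x + (p * s + q * r) * y + 2 * r * s * w, ?_⟩,
        ⟨q ^ 2 * x + q * s * y + s ^ 2 * w, ?_⟩⟩
      · linear_combination p ^ 2 * hx + p * r * hy + r ^ 2 * hw -
          a * (p * s - q * r + 1) * hdet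
      · linear_combination 2 * p * q * hx + (p * s + q * r) * hy + 2 * r * s * hw -
          b * (p * s - q * r + 1) * hdet
      · linear_combination q ^ 2 * hx + q * s * hy + s ^ 2 * hw -
          c * (p * s - q * r + 1) * hdet
    · have hz : z = (p * t + q) / (r * t + s) := by rw [eq_div_iff hden]; exact hm
      rw [hz]
      push_cast
      field_simp
      linear_combination (p * s - q * r) ^ 2 * heq
    · congr 1
      linear_combination -(b ^ 2 - 4 * a * c) * (p * s - q * r + 1) * hdet
  · rintro z m n hz ⟨a, b, c, hprim, heq, rfl⟩ ⟨a', b', c', hprim', heq', rfl⟩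
    have h := int_combo_eq_zero (a := a' * b - a * b') (b := a' * c - a * c') hz (by
      push_cast; linear_combination a' * heq - a * heq')
    have hb : a' * b = a * b' := by linarith [h.1]
    have hc : a' * c = a * c' := by linarith [h.2]
    obtain ⟨ha, hD⟩ := quad_disc_neg hz heq (fun h ↦ hprim (by simp [h.1, h.2.1, h.2.2]))
    obtain ⟨ha', hD'⟩ := quad_disc_neg hz heq' (fun h ↦ hprim' (by simp [h.1, h.2.1, h.2.2]))
    have hle : ∀ {a b c a' b' c' : ℤ}, a' ≠ 0 → a' * b = a * b' → a' * c = a * c' →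
        ¬ ((ℓ : ℤ) ∣ a ∧ (ℓ : ℤ) ∣ b ∧ (ℓ : ℤ) ∣ c) → padicValInt ℓ a ≤ padicValInt ℓ a' := by
      intro a b c a' b' c' ha' hb hc hprim
      by_cases h1 : (ℓ : ℤ) ∣ a
      · by_cases h2 : (ℓ : ℤ) ∣ b
        · exact padicValInt_le_of_mul_eq_mul ha' (fun h3 ↦ hprim ⟨h1, h2, h3⟩) hc
        · exact padicValInt_le_of_mul_eq_mul ha' h2 hb
      · exact padicValInt_le_of_mul_eq_mul ha' h1 (mul_comm _ _)
    have hv : padicValInt ℓ a = padicValInt ℓ a' :=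
      le_antisymm (hle ha' hb hc hprim) (hle ha hb.symm hc.symm hprim')
    have hDD : a' ^ 2 * (b ^ 2 - 4 * a * c) = a ^ 2 * (b' ^ 2 - 4 * a' * c') := by
      linear_combination (a' * b + a * b') * hb - 4 * a * a' * hc
    have := congrArg (padicValInt ℓ) hDD
    rw [padicValInt.mul (by positivity) hD, padicValInt.mul (by positivity) hD', pow_two a',
      pow_two a, padicValInt.mul ha' ha', padicValInt.mul ha ha] at this
    omega
  · rintro z n hz ⟨a, b, c, hprim, heq, rfl⟩
    obtain ⟨-, hD⟩ := quad_disc_neg hz heq (fun h ↦ hprim (by simp [h.1, h.2.1, h.2.2]))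
    by_cases ha : (ℓ : ℤ) ∣ a
    · right
      -- choose `j` with `a j ^ 2 - b j + c` prime to `ℓ`
      obtain ⟨j, hj⟩ : ∃ j : ℤ, ¬ (ℓ : ℤ) ∣ a * j ^ 2 - b * j + c := by
        by_cases hc : (ℓ : ℤ) ∣ c
        · refine ⟨1, fun h ↦ hprim ⟨ha, ?_, hc⟩⟩
          have := (ha.add hc).sub h
          ring_nf at this
          exact this
        · exact ⟨0, by simpa using hc⟩
      refine ⟨j, ?_, fun i _ ↦ ?_⟩
      · refine ⟨_, padicValInt_lt_of_eq_pow_mul 2 two_ne_zero hD ?_, a * ℓ ^ 2,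
          (b - 2 * a * j) * ℓ, a * j ^ 2 - b * j + c, fun h ↦ hj h.2.2, ?_, rfl⟩
        · ring
        · push_cast
          field_simp
          linear_combination heq
      · refine ⟨_, padicValInt_lt_of_eq_pow_mul 4 four_ne_zero hD ?_, a * ℓ ^ 4,
          (b - 2 * a * j) * ℓ ^ 2 - 2 * a * ℓ ^ 3 * i,
          a * ℓ ^ 2 * i ^ 2 - (b - 2 * a * j) * ℓ * i + (a * j ^ 2 - b * j + c),
          fun h ↦ hj ?_, ?_, rfl⟩
        · ring
        · have h1 : (ℓ : ℤ) ∣ a * ℓ ^ 2 * i ^ 2 - (b - 2 * a * j) * ℓ * i :=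
            ⟨a * ℓ * i ^ 2 - (b - 2 * a * j) * i, by ring⟩
          have := h.2.2.sub h1
          ring_nf at this ⊢
          exact this
        · push_cast
          field_simp
          linear_combination heq
    · left
      refine ⟨?_, ?_, fun j hj hjℓ ↦ ?_⟩
      · refine ⟨_, padicValInt_lt_of_eq_pow_mul 2 two_ne_zero hD ?_, a, b * ℓ, c * ℓ ^ 2,
          fun h ↦ ha h.1, ?_, rfl⟩
        · ring
        · push_cast
          linear_combination (ℓ : ℂ) ^ 2 * heq
      · refine ⟨_, padicValInt_lt_of_eq_pow_mul 4 four_ne_zero hD ?_, a, b * ℓ ^ 2, c * ℓ ^ 4,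
          fun h ↦ ha h.1, ?_, rfl⟩
        · ring
        · push_cast
          linear_combination (ℓ : ℂ) ^ 4 * heq
      · refine ⟨_, padicValInt_lt_of_eq_pow_mul 4 four_ne_zero hD ?_, a * ℓ ^ 2,
          b * ℓ ^ 2 - 2 * a * ℓ * j, a * j ^ 2 - b * ℓ * j + c * ℓ ^ 2, fun h ↦ ?_, ?_, rfl⟩
        · ring
        · have h1 : (ℓ : ℤ) ∣ a * j ^ 2 := by
            have := h.2.2.add (⟨b * j - c * ℓ, by ring⟩ : (ℓ : ℤ) ∣ b * ℓ * j - c * ℓ ^ 2)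
            ring_nf at this ⊢
            exact this
          rcases hℓ.dvd_or_dvd h1 with h | h
          · exact ha h
          · have := Int.natCast_dvd_natCast.mp (hℓ.dvd_of_dvd_pow h)
            exact absurd (Nat.le_of_dvd hj this) (by omega)
        · push_cast
          field_simp
          linear_combination (ℓ : ℂ) ^ 2 * heq

/-- Height of a point isogenous to `z₀`: the `ℓ`-adic valuation of the determinant of an
`ℓ`-primitive integral matrix sending `z₀` to the point. -/
def matrixHeight (ℓ : ℕ) (z₀ z : ℂ) (n : ℕ) : Prop :=
  ∃ a b c d : ℤ, ¬ ((ℓ : ℤ) ∣ a ∧ (ℓ : ℤ) ∣ b ∧ (ℓ : ℤ) ∣ c ∧ (ℓ : ℤ) ∣ d) ∧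
    z * (c * z₀ + d) = a * z₀ + b ∧ a * d - b * c ≠ 0 ∧ n = padicValInt ℓ (a * d - b * c)

lemma isHeight_matrix {ℓ : ℕ} [hp : Fact ℓ.Prime] {z₀ : ℂ}
    (hz₀ : ∀ a b c : ℤ, (a : ℂ) * z₀ ^ 2 + b * z₀ + c = 0 → a = 0 ∧ b = 0 ∧ c = 0) :
    IsHeight ℓ (matrixHeight ℓ z₀) := by
  have hℓ : Prime (ℓ : ℤ) := Nat.prime_iff_prime_int.mp hp.out
  have hℓ0 : (ℓ : ℂ) ≠ 0 := by exact_mod_cast hp.out.ne_zero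
  have hℓ0' : (ℓ : ℤ) ≠ 0 := by exact_mod_cast hp.out.ne_zero
  refine ⟨?_, ?_, ?_⟩
  · rintro γ τ n ⟨a, b, c, d, hprim, heq, hn, rfl⟩
    have hdet := Matrix.SpecialLinearGroup.det_coe γ
    rw [Matrix.det_fin_two] at hdet
    have hm := coe_smul_mul_denom γ τ
    set z := ((γ • τ : ℍ) : ℂ)
    set t := (τ : ℂ)
    set p := γ 0 0
    set q := γ 0 1
    set r := γ 1 0
    set s := γ 1 1
    have hdet' : (p * a + q * c) * (r * b + s * d) - (p * b + q * d) * (r * a + s * c) =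
        a * d - b * c := by
      linear_combination (a * d - b * c) * hdet
    refine ⟨p * a + q * c, p * b + q * d, r * a + s * c, r * b + s * d, ?_, ?_, ?_, ?_⟩
    · rintro ⟨⟨x, hx⟩, ⟨y, hy⟩, ⟨u, hu⟩, ⟨v, hv⟩⟩
      refine hprim ⟨⟨s * x - q * u, ?_⟩, ⟨s * y - q * v, ?_⟩, ⟨p * u - r * x, ?_⟩,
        ⟨p * v - r * y, ?_⟩⟩
      · linear_combination s * hx - q * hu - a * hdet
      · linear_combination s * hy - q * hv - b * hdet
      · linear_combination p * hu - r * hx - c * hdet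
      · linear_combination p * hv - r * hy - d * hdet
    · push_cast
      linear_combination (c * z₀ + d) * hm - (r * z - p) * heq
    · rwa [hdet']
    · rw [hdet']
  · rintro z m n hz ⟨a, b, c, d, hprim, heq, hn, rfl⟩ ⟨a', b', c', d', hprim', heq', hn', rfl⟩
    obtain ⟨h1, h2, h3⟩ := hz₀ (a * c' - a' * c) (a * d' + b * c' - a' * d - b' * c)
      (b * d' - b' * d) (by
        push_cast
        linear_combination (c * z₀ + d) * heq' - (c' * z₀ + d') * heq)
    set l := a * d' - b' * c with hl
    have ea : (a' * d' - b' * c') * a = l * a' := by linear_combination -b' * h1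
    have eb : (a' * d' - b' * c') * b = l * b' := by linear_combination a' * h3 - b' * h2
    have ec : (a' * d' - b' * c') * c = l * c' := by linear_combination -d' * h1
    have ed : (a' * d' - b' * c') * d = l * d' := by linear_combination c' * h3 - d' * h2
    have hll : (a * d - b * c) * (a' * d' - b' * c') = l * l := by
      apply mul_left_cancel₀ hn'
      linear_combination (a' * d' - b' * c') * d * ea + l * a' * ed -
        (a' * d' - b' * c') * c * eb - l * b' * ec
    have hl0 : l ≠ 0 := by
      intro h
      rw [h, mul_zero] at hll
      exact mul_ne_zero hn hn' hll
    have hle : ∀ {s t a b c d a' b' c' d' : ℤ}, s ≠ 0 → s * a = t * a' → s * b = t * b' →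
        s * c = t * c' → s * d = t * d' →
        ¬ ((ℓ : ℤ) ∣ a ∧ (ℓ : ℤ) ∣ b ∧ (ℓ : ℤ) ∣ c ∧ (ℓ : ℤ) ∣ d) →
        padicValInt ℓ t ≤ padicValInt ℓ s := by
      intro s t a b c d a' b' c' d' hs ha hb hc hd hprim
      by_cases h1 : (ℓ : ℤ) ∣ a
      · by_cases h2 : (ℓ : ℤ) ∣ b
        · by_cases h3 : (ℓ : ℤ) ∣ c
          · exact padicValInt_le_of_mul_eq_mul hs (fun h4 ↦ hprim ⟨h1, h2, h3, h4⟩) hd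
          · exact padicValInt_le_of_mul_eq_mul hs h3 hc
        · exact padicValInt_le_of_mul_eq_mul hs h2 hb
      · exact padicValInt_le_of_mul_eq_mul hs h1 ha
    have hv := le_antisymm (hle hn' ea eb ec ed hprim)
      (hle hl0 ea.symm eb.symm ec.symm ed.symm hprim')
    have := congrArg (padicValInt ℓ) hll
    rw [padicValInt.mul hn hn', padicValInt.mul hl0 hl0] at this
    omega
  · rintro z n hz ⟨a, b, c, d, hprim, heq, hn, rfl⟩
    have hne : ∀ e : ℕ, (ℓ : ℤ) ^ e * (a * d - b * c) ≠ 0 := fun e ↦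
      mul_ne_zero (pow_ne_zero _ hℓ0') hn
    have key : ∀ (e : ℕ) (z' : ℂ) (a' b' c' d' : ℤ), e ≠ 0 →
        a' * d' - b' * c' = (ℓ : ℤ) ^ e * (a * d - b * c) →
        ¬ ((ℓ : ℤ) ∣ a' ∧ (ℓ : ℤ) ∣ b' ∧ (ℓ : ℤ) ∣ c' ∧ (ℓ : ℤ) ∣ d') →
        z' * (c' * z₀ + d') = a' * z₀ + b' →
        ∃ m > padicValInt ℓ (a * d - b * c), matrixHeight ℓ z₀ z' m :=
      fun e z' a' b' c' d' he hdet hprim' heq' ↦ ⟨_, padicValInt_lt_of_eq_pow_mul e he hn hdet,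
        a', b', c', d', hprim', heq', hdet ▸ hne e, rfl⟩
    by_cases hcd : (ℓ : ℤ) ∣ c ∧ (ℓ : ℤ) ∣ d
    · right
      refine ⟨0, ?_, fun i _ ↦ ?_⟩
      · refine key 1 _ a b (ℓ * c) (ℓ * d) one_ne_zero (by ring)
          (fun h ↦ hprim ⟨h.1, h.2.1, hcd⟩) ?_
        push_cast
        field_simp
        linear_combination heq
      · refine key 2 _ (a + i * (ℓ * c)) (b + i * (ℓ * d)) (ℓ ^ 2 * c) (ℓ ^ 2 * d) two_ne_zero
          (by ring) (fun h ↦ hprim ⟨?_, ?_, hcd⟩) ?_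
        · exact (Int.dvd_add_left (Dvd.intro (i * c) (by ring))).mp h.1
        · exact (Int.dvd_add_left (Dvd.intro (i * d) (by ring))).mp h.2.1
        · push_cast
          field_simp
          linear_combination heq
    · left
      refine ⟨?_, ?_, fun j hj hjℓ ↦ ?_⟩
      · refine key 1 _ (ℓ * a) (ℓ * b) c d one_ne_zero (by ring) (fun h ↦ hcd h.2.2) ?_
        push_cast
        linear_combination (ℓ : ℂ) * heq
      · refine key 2 _ (ℓ ^ 2 * a) (ℓ ^ 2 * b) c d two_ne_zero (by ring) (fun h ↦ hcd h.2.2) ?_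
        push_cast
        linear_combination (ℓ : ℂ) ^ 2 * heq
      · have hjℓ' : ¬ (ℓ : ℤ) ∣ j := fun h ↦
          absurd (Nat.le_of_dvd hj (Int.natCast_dvd_natCast.mp h)) (by omega)
        refine key 2 _ (ℓ * a + j * c) (ℓ * b + j * d) (ℓ * c) (ℓ * d) two_ne_zero (by ring)
          (fun h ↦ hcd ⟨?_, ?_⟩) ?_
        · exact (hℓ.dvd_or_dvd ((Int.dvd_add_right (Dvd.intro a rfl)).mp h.1)).resolve_left hjℓ'
        · exact (hℓ.dvd_or_dvd ((Int.dvd_add_right (Dvd.intro b rfl)).mp h.2.1)).resolve_left hjℓ'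
        · push_cast
          field_simp
          linear_combination (ℓ : ℂ) * heq

lemma exists_isHeight {ℓ : ℕ} [hp : Fact ℓ.Prime] {z₀ : ℂ} (hz : 0 < z₀.im) :
    ∃ R : ℂ → ℕ → Prop, IsHeight ℓ R ∧ ∃ n, R z₀ n := by
  by_cases h : ∀ a b c : ℤ, (a : ℂ) * z₀ ^ 2 + b * z₀ + c = 0 → a = 0 ∧ b = 0 ∧ c = 0
  · refine ⟨_, isHeight_matrix h, _, 1, 0, 0, 1, fun h ↦ ?_, ?_, by simp, rfl⟩
    · exact (Nat.prime_iff_prime_int.mp hp.out).not_dvd_one h.1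
    · simp
  · push Not at h
    have hex : ∃ m : ℕ, ∃ a b c : ℤ, (a : ℂ) * z₀ ^ 2 + b * z₀ + c = 0 ∧ a ≠ 0 ∧ a.natAbs = m := by
      obtain ⟨a, b, c, h, h0⟩ := h
      exact ⟨_, a, b, c, h, (quad_disc_neg hz h (by tauto)).1, rfl⟩
    classical
    obtain ⟨a, b, c, heq, ha, hm⟩ := Nat.find_spec hex
    refine ⟨_, isHeight_quad, _, a, b, c, ?_, heq, rfl⟩
    rintro ⟨⟨x, rfl⟩, ⟨y, rfl⟩, ⟨w, rfl⟩⟩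
    have hx : x ≠ 0 := right_ne_zero_of_mul ha
    refine Nat.find_min hex (m := x.natAbs) ?_ ⟨x, y, w, ?_, hx, rfl⟩
    · rw [← hm, Int.natAbs_mul, Int.natAbs_natCast]
      exact lt_mul_of_one_lt_left (Int.natAbs_pos.mpr hx) hp.out.one_lt
    · have hℓ0 : (ℓ : ℂ) ≠ 0 := by exact_mod_cast hp.out.ne_zero
      apply mul_left_cancel₀ hℓ0
      push_cast at heq
      linear_combination heq

/-- A nonempty set of points of the upper half-plane, invariant under integral translations and
meeting only finitely many `SL(2, ℤ)`-orbits, has a point possessing an `ℓ`-neighbour outside the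
set, none of whose other `ℓ`-neighbours lie in the set. -/
lemma exists_isolated_neighbour {ℓ : ℕ} [hp : Fact ℓ.Prime] {S : Set ℂ} (hne : S.Nonempty)
    (him : ∀ z ∈ S, 0 < z.im) (htrans : ∀ z ∈ S, ∀ j : ℤ, z + j ∈ S) {T : Set ℍ} (hT : T.Finite)
    (hST : ∀ τ : ℍ, (τ : ℂ) ∈ S → ∃ γ : SL(2, ℤ), ∃ τ' ∈ T, γ • τ' = τ) :
    ∃ z ∈ S, (ℓ * z ∉ S ∧ ℓ * (ℓ * z) ∉ S ∧ ∀ j : ℕ, 0 < j → j < ℓ → z + j / ℓ ∉ S) ∨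
      (z / ℓ ∉ S ∧ ∀ i : ℕ, i < ℓ → (z / ℓ + i) / ℓ ∉ S) := by
  obtain ⟨z₀, hz₀⟩ := hne
  obtain ⟨R, hR, n₀, hn₀⟩ := exists_isHeight (ℓ := ℓ) (him z₀ hz₀)
  have hb : {n | ∃ z ∈ S, R z n}.Finite := by
    have : {n | ∃ τ ∈ T, R τ n}.Finite := by
      have : {n | ∃ τ ∈ T, R τ n} = ⋃ τ ∈ T, {n | R τ n} := by ext; simp
      rw [this]
      refine hT.biUnion fun τ _ ↦ Set.Subsingleton.finite fun m hm n hn ↦ ?_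
      exact hR.unique _ _ _ τ.im_pos hm hn
    refine this.subset ?_
    rintro n ⟨z, hz, hn⟩
    obtain ⟨γ, τ, hτ, h⟩ := hST ⟨z, him z hz⟩ hz
    refine ⟨τ, hτ, ?_⟩
    have h' : τ = γ⁻¹ • (⟨z, him z hz⟩ : ℍ) := by rw [← h, inv_smul_smul]
    rw [h']
    exact hR.smul _ _ _ hn
  obtain ⟨n, ⟨z, hz, hn⟩, hmax⟩ := hb.exists_maximal ⟨n₀, z₀, hz₀, hn₀⟩
  have hout : ∀ z', (∃ m > n, R z' m) → z' ∉ S := by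
    rintro z' ⟨m, hm, hRm⟩ hz'
    exact absurd (hmax ⟨z', hz', hRm⟩ hm.le) (by omega)
  rcases hR.step z n (him z hz) hn with ⟨h1, h2, h3⟩ | ⟨j, h1, h2⟩
  · exact ⟨z, hz, .inl ⟨hout _ h1, hout _ h2, fun j h h' ↦ hout _ (h3 j h h')⟩⟩
  · exact ⟨z + j, htrans z hz j, .inr ⟨hout _ h1, fun i h ↦ hout _ (h2 i h)⟩⟩

lemma qExpansionPS_eq (f : ℍ → ℂ) : qExpansionPS f = qExpansion 1 f := by
  ext n
  simp [qExpansionPS, qExpansion_coeff, cuspFunction, div_eq_inv_mul]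

/-- A function on the upper half-plane is (the underlying function of) a modular form of weight
`k`, level `N` and nebentypus `ψ`. -/
structure IsMF {N : ℕ} (k : ℤ) (ψ : DirichletCharacter ℂ N) (f : ℍ → ℂ) : Prop where
  holo : MDiff f
  neben : HasNeben k ψ f
  bdd : ∀ γ : SL(2, ℤ), IsBoundedAtImInfty (f ∣[k] γ)

open Filter Topology Asymptotics

variable {N : ℕ} {k k₁ k₂ w : ℤ} {ψ ψ₁ ψ₂ χ : DirichletCharacter ℂ N} {f g F G : ℍ → ℂ}

lemma ModularForm.isMF [NeZero N] (f : ModularForm (Gamma1 N) k) (hf : HasNeben k ψ f) :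
    IsMF k ψ f where
  holo := f.holo'
  neben := hf
  bdd γ := by
    exact ModularFormClass.bdd_at_infty_slash f γ

lemma IsMF.exists_modularForm [NeZero N] (hf : IsMF k ψ f) :
    ∃ F : ModularForm (Gamma1 N) k, ⇑F = f := by
  refine ⟨⟨⟨f, ?_⟩, hf.holo, ?_⟩, rfl⟩
  · rintro _ ⟨γ, hγ, rfl⟩
    have h0 : γ ∈ Gamma0 N := by
      rw [SetLike.mem_coe, Gamma1_mem] at hγ
      rw [Gamma0_mem]; exact hγ.2.2
    have := hf.neben γ h0
    rw [SetLike.mem_coe, Gamma1_mem] at hγ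
    rw [hγ.2.1] at this
    have h1 : f ∣[k] γ = f := by simpa using this
    exact h1
  · intro c hc
    rw [Subgroup.IsArithmetic.isCusp_iff_isCusp_SL2Z] at hc
    rw [OnePoint.isBoundedAt_iff_forall_SL2Z hc]
    exact fun γ _ => hf.bdd γ

lemma IsMF.mul (hf : IsMF k₁ ψ₁ f) (hg : IsMF k₂ ψ₂ g) : IsMF (k₁ + k₂) (ψ₁ * ψ₂) (f * g) where
  holo := hf.holo.mul hg.holo
  neben γ hγ := by
    rw [ModularForm.mul_slash_SL2, hf.neben γ hγ, hg.neben γ hγ]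
    ext; simp; ring
  bdd γ := by
    rw [ModularForm.mul_slash_SL2]
    exact (hf.bdd γ).mul (hg.bdd γ)

lemma IsMF.add (hf : IsMF k ψ f) (hg : IsMF k ψ g) : IsMF k ψ (f + g) where
  holo := hf.holo.add hg.holo
  neben γ hγ := by
    rw [SlashAction.add_slash, hf.neben γ hγ, hg.neben γ hγ, smul_add]
  bdd γ := by
    rw [SlashAction.add_slash]
    exact (hf.bdd γ).add (hg.bdd γ)

lemma IsMF.smul (c : ℂ) (hf : IsMF k ψ f) : IsMF k ψ (c • f) where
  holo := hf.holo.const_smul c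
  neben γ hγ := by
    rw [ModularForm.SL_smul_slash, hf.neben γ hγ, smul_comm]
  bdd γ := by
    rw [ModularForm.SL_smul_slash]
    exact Filter.BoundedAtFilter.smul c (hf.bdd γ)

/-- The integral translation matrix `(1 n; 0 1)`. -/
lemma exists_translation (n : ℤ) : ∃ γ : SL(2, ℤ), γ 0 0 = 1 ∧ γ 0 1 = n ∧ γ 1 0 = 0 ∧ γ 1 1 = 1 :=
  ⟨⟨!![1, n; 0, 1], by simp⟩, rfl, rfl, rfl, rfl⟩

lemma periodic_comp_ofComplex {h : ℝ} {f : ℍ → ℂ} (hf : ∀ τ : ℍ, f (h +ᵥ τ) = f τ) :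
    Periodic (f ∘ ofComplex) h := by
  intro w
  by_cases hw : 0 < w.im
  · have hw' : 0 < (w + h).im := by simpa using hw
    simp only [comp_apply, ofComplex_apply_of_im_pos hw, ofComplex_apply_of_im_pos hw']
    rw [← hf ⟨w, hw⟩]
    congr 1
    ext
    simp [add_comm]
  · have hw' : (w + h).im ≤ 0 := by simpa using hw
    simp [ofComplex_apply_of_im_nonpos (not_lt.mp hw), ofComplex_apply_of_im_nonpos hw']

/-- The weight-`k` slash by any matrix has `N` as a period. -/
lemma HasNeben.slash_vadd (hf : HasNeben k ψ f) (γ : SL(2, ℤ)) (τ : ℍ) :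
    (f ∣[k] γ) ((N : ℝ) +ᵥ τ) = (f ∣[k] γ) τ := by
  obtain ⟨t, h00, h01, h10, h11⟩ := exists_translation N
  have key : (f ∣[k] γ) ∣[k] t = f ∣[k] γ := by
    have : γ * t = (γ * t * γ⁻¹) * γ := by group
    have hN : ((γ * t * γ⁻¹ : SL(2, ℤ)) 1 1 : ZMod N) = 1 ∧ γ * t * γ⁻¹ ∈ Gamma0 N := by
      have hd := γ.det_coe
      rw [Matrix.det_fin_two] at hd
      constructor
      · simp [Matrix.SpecialLinearGroup.coe_mul, Matrix.mul_apply, Fin.sum_univ_two,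
          Matrix.SpecialLinearGroup.coe_inv, Matrix.adjugate_fin_two, h00, h01, h10, h11]
        have := congrArg (Int.cast : ℤ → ZMod N) hd
        push_cast at this
        linear_combination this
      · rw [Gamma0_mem]
        simp [Matrix.SpecialLinearGroup.coe_mul, Matrix.mul_apply, Fin.sum_univ_two,
          Matrix.SpecialLinearGroup.coe_inv, Matrix.adjugate_fin_two, h00, h01, h10, h11]
        ring
    rw [← SlashAction.slash_mul, this, SlashAction.slash_mul, hf _ hN.2, hN.1]
    simp
  have h2 := congrFun key τ
  rw [ModularForm.SL_slash_apply] at h2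
  have e : t • τ = (N : ℝ) +ᵥ τ := by
    apply UpperHalfPlane.ext
    have := coe_smul_mul_denom t τ
    simp only [h00, h01, h10, h11] at this
    simpa [add_comm] using this
  have d : denom t τ = 1 := by
    simp [denom, h10, h11]
  rw [e, d] at h2
  simpa using h2

lemma IsMF.vadd_one (hf : IsMF k ψ f) (τ : ℍ) : f ((1 : ℝ) +ᵥ τ) = f τ := by
  obtain ⟨t, h00, h01, h10, h11⟩ := exists_translation 1
  have key : f ∣[k] t = f := by
    rw [hf.neben t (by rw [Gamma0_mem, h10]; simp), h11]
    simp
  have h2 := congrFun key τ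
  rw [ModularForm.SL_slash_apply] at h2
  have e : t • τ = (1 : ℝ) +ᵥ τ := by
    apply UpperHalfPlane.ext
    have := coe_smul_mul_denom t τ
    simp only [h00, h01, h10, h11] at this
    simpa [add_comm] using this
  have d : denom t τ = 1 := by
    simp [denom, h10, h11]
  rw [e, d] at h2
  simpa using h2

lemma IsMF.bdd_one (hf : IsMF k ψ f) : IsBoundedAtImInfty f := by
  simpa using hf.bdd 1

lemma IsMF.periodic (hf : IsMF k ψ f) : Periodic (f ∘ ofComplex) (1 : ℝ) :=
  periodic_comp_ofComplex hf.vadd_one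

lemma IsMF.analyticAt (hf : IsMF k ψ f) : AnalyticAt ℂ (cuspFunction 1 f) 0 :=
  analyticAt_cuspFunction_zero one_pos hf.periodic hf.holo hf.bdd_one

lemma IsMF.qExpansionL_mul (hf : IsMF k₁ ψ₁ f) (hg : IsMF k₂ ψ₂ g) :
    qExpansionL (f * g) = qExpansionL f * qExpansionL g := by
  simp only [qExpansionL, qExpansionPS_eq]
  rw [qExpansion_mul hf.analyticAt hg.analyticAt, map_mul]

lemma IsMF.qExpansionL_add (hf : IsMF k₁ ψ₁ f) (hg : IsMF k₂ ψ₂ g) :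
    qExpansionL (f + g) = qExpansionL f + qExpansionL g := by
  simp only [qExpansionL, qExpansionPS_eq]
  rw [qExpansion_add hf.analyticAt hg.analyticAt, map_add]

lemma IsMF.qExpansionL_smul (hf : IsMF k₁ ψ₁ f) (c : ℂ) :
    qExpansionL (c • f) = c • qExpansionL f := by
  simp only [qExpansionL, qExpansionPS_eq]
  rw [qExpansion_smul hf.analyticAt, PowerSeries.smul_eq_C_mul, map_mul, HahnSeries.ofPowerSeries_C,
    HahnSeries.C_mul_eq_smul]

lemma IsMF.qExpansionL_eq_zero_iff (hf : IsMF k ψ f) : qExpansionL f = 0 ↔ f = 0 := by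
  rw [qExpansionL, qExpansionPS_eq, map_eq_zero_iff _ HahnSeries.ofPowerSeries_injective,
    qExpansion_eq_zero_iff one_pos hf.periodic hf.holo hf.bdd_one]

lemma exists_common_denominator [NeZero N] {V : Submodule ℂ (LaurentSeries ℂ)} (hV : V.FG)
    (hratio : ∀ h ∈ V, IsModularRatio N k χ h) :
    ∃ (w : ℤ) (ψ : DirichletCharacter ℂ N) (G : ℍ → ℂ), IsMF w ψ G ∧ G ≠ 0 ∧
      ∀ h ∈ V, ∃ F, IsMF (w + k) (χ * ψ) F ∧ qExpansionL F = h * qExpansionL G := by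
  induction V, hV using Submodule.fg_induction with
  | singleton x =>
    obtain ⟨w, -, ψ, G, F, hG0, hG, hF, h⟩ := hratio x (Submodule.mem_span_singleton_self x)
    refine ⟨w, ψ, G, ModularForm.isMF G hG, fun h0 => hG0 (DFunLike.coe_injective h0), ?_⟩
    intro y hy
    obtain ⟨c, rfl⟩ := Submodule.mem_span_singleton.mp hy
    refine ⟨_, (ModularForm.isMF F hF).smul c, ?_⟩
    rw [(ModularForm.isMF F hF).qExpansionL_smul, h, ← HahnSeries.C_mul_eq_smul,
      ← HahnSeries.C_mul_eq_smul, mul_assoc]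
  | sup V₁ V₂ h₁ h₂ ih₁ ih₂ =>
    obtain ⟨w₁, ψ₁, G₁, hG₁, h0₁, H₁⟩ := ih₁ fun h hh => hratio h (Submodule.mem_sup_left hh)
    obtain ⟨w₂, ψ₂, G₂, hG₂, h0₂, H₂⟩ := ih₂ fun h hh => hratio h (Submodule.mem_sup_right hh)
    refine ⟨_, _, _, hG₁.mul hG₂, ?_, ?_⟩
    · rw [Ne, UpperHalfPlane.mul_eq_zero_iff hG₁.holo hG₂.holo]
      tauto
    · intro h hh
      obtain ⟨y, hy, z, hz, rfl⟩ := Submodule.mem_sup.mp hh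
      obtain ⟨F₁, hF₁, e₁⟩ := H₁ y hy
      obtain ⟨F₂, hF₂, e₂⟩ := H₂ z hz
      have a₁ : IsMF (w₁ + w₂ + k) (χ * (ψ₁ * ψ₂)) (F₁ * G₂) := by
        convert! hF₁.mul hG₂ using 1
        · ring
        · rw [mul_assoc]
      have a₂ : IsMF (w₁ + w₂ + k) (χ * (ψ₁ * ψ₂)) (G₁ * F₂) := by
        convert! hG₁.mul hF₂ using 1
        · ring
        · rw [mul_left_comm]
      refine ⟨_, a₁.add a₂, ?_⟩
      rw [a₁.qExpansionL_add a₂, hF₁.qExpansionL_mul hG₂, hG₁.qExpansionL_mul hF₂,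
        hG₁.qExpansionL_mul hG₂, e₁, e₂]
      ring

lemma exists_cuspFunction_factorization {h : ℝ} (hh : 0 < h)
    (hper : Periodic (f ∘ ofComplex) h) (hf : MDiff f) (hb : IsBoundedAtImInfty f) (h0 : f ≠ 0) :
    ∃ (m : ℕ) (g : ℂ → ℂ), AnalyticAt ℂ g 0 ∧ g 0 ≠ 0 ∧
      ∀ᶠ z in 𝓝 0, cuspFunction h f z = z ^ m * g z := by
  have := (analyticAt_cuspFunction_zero hh hper hf hb).exists_eventuallyEq_pow_smul_nonzero_iff.2
    (fun hz => h0 ((qExpansion_eq_zero_iff hh hper hf hb).1 ?_))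
  · simpa using this
  · ext n
    have hz' : cuspFunction h f =ᶠ[𝓝 0] 0 := hz
    rw [qExpansion_coeff, hz'.iteratedDeriv_eq]
    simp

lemma exp_isBigO_of_ne_zero {h : ℝ} (hh : 0 < h)
    (hper : Periodic (f ∘ ofComplex) h) (hf : MDiff f) (hb : IsBoundedAtImInfty f) (h0 : f ≠ 0) :
    ∃ M : ℝ, (fun τ : ℍ => Real.exp (-M * τ.im)) =O[atImInfty] f := by
  obtain ⟨m, g, hg, hg0, hev⟩ := exists_cuspFunction_factorization hh hper hf hb h0
  refine ⟨2 * Real.pi * m / h, ?_⟩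
  have hq := UpperHalfPlane.qParam_tendsto_atImInfty hh
  have hpos : 0 < ‖g 0‖ := norm_pos_iff.mpr hg0
  refine IsBigO.of_bound (‖g 0‖ / 2)⁻¹ ?_
  filter_upwards [hq.eventually hev,
    hq.eventually (hg.continuousAt.norm.eventually (lt_mem_nhds (half_lt_self hpos)))] with τ h1 h2
  rw [eq_cuspFunction τ hh.ne' hper] at h1
  have h3 : ‖Periodic.qParam h τ‖ ^ m = Real.exp (-(2 * Real.pi * m / h) * τ.im) := by
    rw [Periodic.norm_qParam, ← Real.exp_nat_mul]
    congr 1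
    simp
    ring
  rw [h1, norm_mul, norm_pow, h3, Real.norm_of_nonneg (Real.exp_nonneg _),
    le_inv_mul_iff₀ (by positivity), mul_comm]
  gcongr

/-- The formal Taylor series at `0`. -/
def taylorPS (φ : ℂ → ℂ) : PowerSeries ℂ :=
  PowerSeries.mk fun n => iteratedDeriv n φ 0 / n.factorial

lemma taylorPS_mul {φ φ' : ℂ → ℂ} (hf : AnalyticAt ℂ φ 0) (hg : AnalyticAt ℂ φ' 0) :
    taylorPS (φ * φ') = taylorPS φ * taylorPS φ' := by
  ext
  simp only [taylorPS, PowerSeries.coeff_mk,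
    iteratedDeriv_mul hf.contDiffAt hg.contDiffAt, Finset.sum_div, PowerSeries.coeff_mul,
    Finset.Nat.sum_antidiagonal_eq_sum_range_succ_mk, Nat.succ_eq_add_one]
  refine Finset.sum_congr rfl fun i hi ↦ ?_
  rw [Nat.cast_choose _ (by grind)]
  field_simp [Nat.factorial_ne_zero]

lemma taylorPS_congr {φ φ' : ℂ → ℂ} (h : φ =ᶠ[𝓝 0] φ') : taylorPS φ = taylorPS φ' := by
  ext n
  simp [taylorPS, h.iteratedDeriv_eq]

lemma taylorPS_pow (m : ℕ) : taylorPS (fun z => z ^ m) = PowerSeries.X ^ m := by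
  ext n
  simp only [taylorPS, PowerSeries.coeff_mk, iteratedDeriv_fun_pow_zero, PowerSeries.coeff_X_pow]
  split_ifs with h
  · subst h; field_simp [Nat.factorial_ne_zero]
  · simp

lemma eventually_hasSum_taylorPS {φ : ℂ → ℂ} (hf : AnalyticAt ℂ φ 0) :
    ∀ᶠ z in 𝓝 0, HasSum (fun n => (taylorPS φ).coeff n * z ^ n) (φ z) := by
  filter_upwards [hf.hasFPowerSeriesAt.eventually_hasSum] with z hz
  simpa [taylorPS, mul_comm, FormalMultilinearSeries.coeff_ofScalars] using hz

lemma taylorPS_ne_zero {φ : ℂ → ℂ} (h : φ 0 ≠ 0) : taylorPS φ ≠ 0 := by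
  intro h0
  have := congrArg (PowerSeries.coeff 0) h0
  simp [taylorPS] at this
  exact h this

/-- The Laurent series of a modular ratio converges to the ratio near the cusp `∞`. -/
lemma hasSum_modularRatio (hF : IsMF k₁ ψ₁ F) (hG : IsMF k₂ ψ₂ G) (hG0 : G ≠ 0)
    {h : LaurentSeries ℂ} (e : qExpansionL F = h * qExpansionL G) :
    ∀ᶠ τ : ℍ in atImInfty,
      HasSum (fun n : ℤ => h.coeff n * Periodic.qParam 1 τ ^ n) (F τ / G τ) := by
  obtain ⟨m, g, hg, hg0, hev⟩ :=
    exists_cuspFunction_factorization one_pos hG.periodic hG.holo hG.bdd_one hG0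
  set Fc := cuspFunction 1 F with hFc
  set u : ℂ → ℂ := Fc * g⁻¹ with hu
  have hua : AnalyticAt ℂ u 0 := hF.analyticAt.mul (hg.inv hg0)
  have hgne : ∀ᶠ z in 𝓝 (0 : ℂ), g z ≠ 0 := hg.continuousAt.eventually_ne hg0
  have e1 : qExpansionPS F = taylorPS u * taylorPS g := by
    rw [← taylorPS_mul hua hg]
    apply taylorPS_congr
    filter_upwards [hgne] with z hz
    simp [hu, hFc, cuspFunction, hz]
  have e2 : qExpansionPS G = PowerSeries.X ^ m * taylorPS g := by
    rw [← taylorPS_pow, ← taylorPS_mul (by fun_prop) hg]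
    exact taylorPS_congr hev
  have e3 : HahnSeries.ofPowerSeries ℤ ℂ (taylorPS u) = h * HahnSeries.single (m : ℤ) 1 := by
    rw [qExpansionL, qExpansionL, e1, e2, map_mul, map_mul, HahnSeries.ofPowerSeries_X_pow,
      ← mul_assoc] at e
    exact mul_right_cancel₀ (by
      rw [Ne, map_eq_zero_iff _ HahnSeries.ofPowerSeries_injective]; exact taylorPS_ne_zero hg0) e
  have hcoeff : ∀ n : ℤ, h.coeff (n - m) = (HahnSeries.ofPowerSeries ℤ ℂ (taylorPS u)).coeff n := by
    intro n
    rw [e3]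
    conv_rhs => rw [show n = (n - m) + m by ring]
    rw [HahnSeries.coeff_mul_single_add, mul_one]
  have hq := UpperHalfPlane.qParam_tendsto_atImInfty (one_pos)
  filter_upwards [hq.eventually (eventually_hasSum_taylorPS hua), hq.eventually hgne,
    hq.eventually hev] with τ h1 h2 h3
  set q := Periodic.qParam 1 τ with hqdef
  have hq0 : q ≠ 0 := Complex.exp_ne_zero _
  rw [hqdef, eq_cuspFunction τ one_ne_zero hG.periodic, ← hqdef] at h3
  have h4 : u q = F τ / g q := by
    simp only [hu, hFc, Pi.mul_apply, Pi.inv_apply]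
    rw [hqdef, eq_cuspFunction τ one_ne_zero hF.periodic, ← hqdef, div_eq_mul_inv]
  have hinj : Function.Injective (fun n : ℕ => (n : ℤ) - m) := fun a b hab => by
    simpa using hab
  rw [← hinj.hasSum_iff]
  · have h5 := h1.mul_right (q ^ m)⁻¹
    rw [h4] at h5
    convert! h5 using 1
    · ext n
      simp only [comp_apply, hcoeff, zpow_sub₀ hq0, zpow_natCast]
      rw [HahnSeries.ofPowerSeries_apply_coeff]
      ring
    · rw [h3]; field_simp
  · intro n hn
    rw [show n = (n + m) - m by ring, hcoeff, HahnSeries.ofPowerSeries_apply,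
      HahnSeries.embDomain_of_notMem_range, zero_mul]
    rintro ⟨a, ha⟩
    exact hn ⟨a, by simp at ha; simp [ha]⟩

lemma exists_finite_coset_representatives (N : ℕ) [NeZero N] :
    ∃ R : Set SL(2, ℤ), R.Finite ∧ ∀ γ : SL(2, ℤ), ∃ δ ∈ Gamma0 N, ∃ r ∈ R, γ = δ * r := by
  have : (Gamma0 N).FiniteIndex := inferInstance
  have hfin : Finite (SL(2, ℤ) ⧸ Gamma0 N) := inferInstance
  refine ⟨Set.range fun q : SL(2, ℤ) ⧸ Gamma0 N => (Quotient.out q)⁻¹, Set.finite_range _, ?_⟩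
  intro γ
  obtain ⟨δ, hδ⟩ := QuotientGroup.mk_out_eq_mul (Gamma0 N) γ⁻¹
  exact ⟨δ, δ.2, _, ⟨_, rfl⟩, by dsimp only; rw [hδ]; group⟩

lemma HasNeben.slash_mul (hf : HasNeben k ψ f) {δ : SL(2, ℤ)} (hδ : δ ∈ Gamma0 N) (r : SL(2, ℤ)) :
    f ∣[k] (δ * r) = ψ ((δ 1 1 : ℤ) : ZMod N) • f ∣[k] r := by
  rw [SlashAction.slash_mul, hf δ hδ, ModularForm.SL_smul_slash]

lemma isUnit_of_mem_Gamma0 {δ : SL(2, ℤ)} (hδ : δ ∈ Gamma0 N) :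
    IsUnit ((δ 1 1 : ℤ) : ZMod N) := by
  rw [Gamma0_mem] at hδ
  have hd := δ.det_coe
  rw [Matrix.det_fin_two] at hd
  have := congrArg (Int.cast : ℤ → ZMod N) hd
  push_cast at this
  rw [hδ, mul_zero, sub_zero, mul_comm] at this
  exact IsUnit.of_mul_eq_one _ this

lemma character_ne_zero (ψ : DirichletCharacter ℂ N) {δ : SL(2, ℤ)} (hδ : δ ∈ Gamma0 N) :
    ψ ((δ 1 1 : ℤ) : ZMod N) ≠ 0 :=
  ((isUnit_of_mem_Gamma0 hδ).map ψ).ne_zero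

lemma norm_character (ψ : DirichletCharacter ℂ N) {δ : SL(2, ℤ)} (hδ : δ ∈ Gamma0 N) :
    ‖ψ ((δ 1 1 : ℤ) : ZMod N)‖ = 1 := by
  obtain ⟨u, hu⟩ := isUnit_of_mem_Gamma0 hδ
  rw [← hu]; exact ψ.unit_norm_eq_one u

lemma slash_apply_eq_zero_iff (γ : SL(2, ℤ)) (τ : ℍ) : (f ∣[k] γ) τ = 0 ↔ f (γ • τ) = 0 := by
  rw [ModularForm.SL_slash_apply]
  simp [zpow_ne_zero _ (denom_ne_zero _ τ)]

lemma slash_ne_zero (hf : f ≠ 0) (γ : SL(2, ℤ)) : f ∣[k] γ ≠ 0 := by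
  intro h
  apply hf
  rw [← SlashAction.slash_one (G := SL(2, ℤ)) k f, ← mul_inv_cancel γ, SlashAction.slash_mul, h,
    SlashAction.zero_slash]

lemma mdifferentiable_slash (hf : MDiff f) (k : ℤ) (γ : SL(2, ℤ)) : MDiff (f ∣[k] γ) :=
  hf.slash k _

lemma IsMF.exp_isBigO_slash [NeZero N] (hf : IsMF k ψ f) (h0 : f ≠ 0) (γ : SL(2, ℤ)) :
    ∃ M : ℝ, (fun τ : ℍ => Real.exp (-M * τ.im)) =O[atImInfty] (f ∣[k] γ) :=
  exp_isBigO_of_ne_zero (h := N) (by exact_mod_cast NeZero.pos N)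
    (periodic_comp_ofComplex (hf.neben.slash_vadd γ)) (mdifferentiable_slash hf.holo k γ) (hf.bdd γ)
    (slash_ne_zero h0 γ)

lemma finite_zeros_fundamentalDomain (hf : MDiff f) (h0 : f ≠ 0)
    (hinf : ∀ᶠ τ in atImInfty, f τ ≠ 0) : {τ | τ ∈ ModularGroup.fd ∧ f τ = 0}.Finite := by
  obtain ⟨A, hA⟩ := (atImInfty_mem _).1 hinf
  by_contra hfin
  obtain ⟨x, -, hx⟩ := Set.Infinite.exists_accPt_of_subset_isCompact hfin
    (ModularGroup.isCompact_truncatedFundamentalDomain A) (fun τ hτ => ⟨hτ.1, by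
      by_contra! hlt
      exact hA τ hlt.le hτ.2⟩)
  refine h0 (eq_zero_of_frequently hf (τ := x) ?_)
  rw [accPt_iff_frequently_nhdsNE] at hx
  exact hx.mono fun y hy => hy.2

lemma IsMF.zeros_finite [NeZero N] (hf : IsMF k ψ f) (h0 : f ≠ 0) :
    ∃ T : Set ℍ, T.Finite ∧ ∀ τ, f τ = 0 → ∃ γ : SL(2, ℤ), ∃ τ' ∈ T, γ • τ' = τ := by
  obtain ⟨R, hR, hcos⟩ := exists_finite_coset_representatives N
  refine ⟨⋃ r ∈ R, {τ | τ ∈ ModularGroup.fd ∧ (f ∣[k] r) τ = 0}, hR.biUnion fun r _ => ?_, ?_⟩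
  · refine finite_zeros_fundamentalDomain (mdifferentiable_slash hf.holo k r)
      (slash_ne_zero h0 r) ?_
    obtain ⟨M, hM⟩ := hf.exp_isBigO_slash h0 r
    filter_upwards [hM.eq_zero_imp] with τ hτ h
    exact (Real.exp_pos _).ne' (hτ h)
  · intro τ hτ
    obtain ⟨γ, hγ⟩ := ModularGroup.exists_smul_mem_fd τ
    obtain ⟨δ, hδ, r, hr, e⟩ := hcos γ⁻¹
    refine ⟨γ⁻¹, γ • τ, Set.mem_biUnion hr ⟨hγ, ?_⟩, inv_smul_smul γ τ⟩
    have : (f ∣[k] (δ * r)) (γ • τ) = 0 := by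
      rw [slash_apply_eq_zero_iff, ← e, inv_smul_smul, hτ]
    rw [hf.neben.slash_mul hδ] at this
    exact (mul_eq_zero.1 this).resolve_left (character_ne_zero ψ hδ)

lemma sum_zpow_of_isPrimitiveRoot {ℓ : ℕ} {ζ : ℂ} (hζ : IsPrimitiveRoot ζ ℓ) (n : ℤ) :
    ∑ j ∈ Finset.range ℓ, (ζ ^ j) ^ n = if (ℓ : ℤ) ∣ n then (ℓ : ℂ) else 0 := by
  have h1 : ∀ j : ℕ, (ζ ^ j) ^ n = (ζ ^ n) ^ j := fun j => by
    rw [← zpow_natCast, ← zpow_natCast, ← zpow_mul, ← zpow_mul, mul_comm]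
  simp only [h1]
  split_ifs with h
  · rw [(hζ.zpow_eq_one_iff_dvd n).2 h]; simp
  · have hne : ζ ^ n ≠ 1 := fun h' => h ((hζ.zpow_eq_one_iff_dvd n).1 h')
    rw [geom_sum_eq hne, ← h1 ℓ, hζ.pow_eq_one]
    simp

lemma hecke_identity_of_hasSum {ℓ : ℕ} (hℓ : 0 < ℓ) {a b : ℤ → ℂ} {c z X Y : ℂ} {W : ℕ → ℂ}
    (hab : ∀ n : ℤ, b n = a (ℓ * n) + c * (if (ℓ : ℤ) ∣ n then a (n / ℓ) else 0))
    (hY : HasSum (fun n : ℤ => b n * Periodic.qParam 1 z ^ n) Y)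
    (hX : HasSum (fun n : ℤ => a n * Periodic.qParam 1 (ℓ * z) ^ n) X)
    (hW : ∀ j ∈ Finset.range ℓ,
      HasSum (fun n : ℤ => a n * Periodic.qParam 1 ((z + j) / ℓ) ^ n) (W j)) :
    ℓ * Y = ∑ j ∈ Finset.range ℓ, W j + ℓ * c * X := by
  have hℓ0 : (ℓ : ℂ) ≠ 0 := by exact_mod_cast hℓ.ne'
  have hℓz : (ℓ : ℤ) ≠ 0 := by exact_mod_cast hℓ.ne'
  set p := Periodic.qParam 1 (z / ℓ) with hp
  have hp0 : p ≠ 0 := Complex.exp_ne_zero _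
  set ζ := Complex.exp (2 * Real.pi * Complex.I / ℓ) with hζdef
  have hζ : IsPrimitiveRoot ζ ℓ := Complex.isPrimitiveRoot_exp ℓ hℓ.ne'
  have e1 : ∀ j : ℕ, Periodic.qParam 1 ((z + j) / ℓ) = p * ζ ^ j := by
    intro j
    rw [hp, hζdef, Periodic.qParam, Periodic.qParam, ← Complex.exp_nat_mul, ← Complex.exp_add]
    congr 1
    field_simp
    simp
  have e2 : Periodic.qParam 1 z = p ^ (ℓ : ℤ) := by
    rw [hp, Periodic.qParam, Periodic.qParam, zpow_natCast, ← Complex.exp_nat_mul]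
    congr 1
    field_simp
  have e3 : Periodic.qParam 1 (ℓ * z) = Periodic.qParam 1 z ^ (ℓ : ℤ) := by
    rw [Periodic.qParam, Periodic.qParam, zpow_natCast, ← Complex.exp_nat_mul]
    congr 1
    field_simp
  have hinj : Function.Injective (fun n : ℤ => (ℓ : ℤ) * n) := mul_right_injective₀ hℓz
  have h1 := hasSum_sum hW
  simp only [e1] at h1
  have h2 : HasSum (fun n : ℤ => ℓ * (a (ℓ * n) * Periodic.qParam 1 z ^ n))
      (∑ j ∈ Finset.range ℓ, W j) := by
    rw [← hinj.hasSum_iff] at h1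
    · convert! h1 using 1
      ext n
      simp only [comp_apply, mul_zpow, ← mul_assoc]
      rw [← Finset.mul_sum, sum_zpow_of_isPrimitiveRoot hζ, if_pos (dvd_mul_right _ _), e2,
        ← zpow_mul]
      ring
    · intro n hn
      simp only [mul_zpow, ← mul_assoc]
      rw [← Finset.mul_sum, sum_zpow_of_isPrimitiveRoot hζ, if_neg, mul_zero]
      rintro ⟨m, rfl⟩
      exact hn ⟨m, rfl⟩
  have h3 : HasSum (fun n : ℤ => (if (ℓ : ℤ) ∣ n then a (n / ℓ) else 0) *
      Periodic.qParam 1 z ^ n) X := by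
    rw [← hinj.hasSum_iff]
    · convert! hX using 1
      ext n
      simp only [comp_apply]
      rw [if_pos (dvd_mul_right _ _), Int.mul_ediv_cancel_left _ hℓz, e3, ← zpow_mul]
    · intro n hn
      rw [if_neg, zero_mul]
      rintro ⟨m, rfl⟩
      exact hn ⟨m, rfl⟩
  have h4 := h2.add (h3.mul_left (ℓ * c))
  have h5 := hY.mul_left (ℓ : ℂ)
  refine h5.unique ?_
  convert! h4 using 1
  ext n
  rw [hab]
  ring

/-- The meromorphic function `F / G` on the upper half-plane, as a function on `ℂ`. -/
def ratioFun (F G : ℍ → ℂ) (z : ℂ) : ℂ := (F ∘ ofComplex) z / (G ∘ ofComplex) z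

lemma analyticAt_comp_ofComplex (hF : MDiff F) {z : ℂ} (hz : 0 < z.im) :
    AnalyticAt ℂ (F ∘ ofComplex) z :=
  ((UpperHalfPlane.mdifferentiable_iff.1 hF).analyticOnNhd isOpen_upperHalfPlaneSet) z hz

lemma meromorphicAt_ratioFun (hF : MDiff F) (hG : MDiff G) {z : ℂ} (hz : 0 < z.im) :
    MeromorphicAt (ratioFun F G) z :=
  (analyticAt_comp_ofComplex hF hz).meromorphicAt.div (analyticAt_comp_ofComplex hG hz).meromorphicAt

lemma meromorphicAt_ratioFun_comp (hF : MDiff F) (hG : MDiff G) {φ : ℂ → ℂ} {z : ℂ}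
    (hφ : AnalyticAt ℂ φ z) (hz : 0 < (φ z).im) :
    MeromorphicAt (fun u => ratioFun F G (φ u)) z :=
  ((analyticAt_comp_ofComplex hF hz).comp hφ).meromorphicAt.div
    ((analyticAt_comp_ofComplex hG hz).comp hφ).meromorphicAt

lemma ratioFun_add_int (hF : Periodic (F ∘ ofComplex) (1 : ℝ)) (hG : Periodic (G ∘ ofComplex) (1 : ℝ))
    (j : ℤ) (z : ℂ) : ratioFun F G (z + j) = ratioFun F G z := by
  have h : Periodic (ratioFun F G) (1 : ℝ) := fun z => by simp only [ratioFun, hF z, hG z]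
  simpa using h.int_mul j z

/-- A function meromorphic on the upper half-plane which vanishes near the cusp `∞` vanishes. -/
lemma eventually_eq_zero_of_meromorphic {D : ℂ → ℂ} (hD : ∀ z : ℂ, 0 < z.im → MeromorphicAt D z)
    {A : ℝ} (h0 : ∀ z : ℂ, A < z.im → D z = 0) {z : ℂ} (hz : 0 < z.im) :
    ∀ᶠ u in 𝓝[≠] z, D u = 0 := by
  rw [← meromorphicOrderAt_eq_top_iff]
  by_contra hne
  set B := max A 0 + 1
  have hB : 0 < B := by positivity
  have hBim : 0 < ((B : ℂ) * Complex.I).im := by simpa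
  have := MeromorphicOn.meromorphicOrderAt_ne_top_of_isPreconnected (U := {z : ℂ | 0 < z.im})
    (y := (B : ℂ) * Complex.I) hD (convex_halfSpace_im_gt 0).isPreconnected hz hBim hne
  apply this
  rw [meromorphicOrderAt_eq_top_iff]
  apply eventually_nhdsWithin_of_eventually_nhds
  have : ∀ᶠ u : ℂ in 𝓝 ((B : ℂ) * Complex.I), A < u.im := by
    apply Complex.continuous_im.continuousAt.eventually (lt_mem_nhds _)
    simp only [Complex.mul_I_im, Complex.ofReal_re, B]
    linarith [le_max_left A 0]
  exact this.mono fun u hu => h0 u hu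

lemma im_add_div {ℓ : ℕ} (j : ℕ) (z : ℂ) : ((z + j) / (ℓ : ℂ)).im = z.im / ℓ := by
  rw [Complex.div_natCast_im]; simp

lemma im_natCast_mul {ℓ : ℕ} (z : ℂ) : ((ℓ : ℂ) * z).im = ℓ * z.im := by
  simp

lemma hecke_identity {ℓ : ℕ} (hℓ : 0 < ℓ) {c : ℂ} {F₁ F₂ : ℍ → ℂ} (hF₁ : IsMF k₁ ψ₁ F₁)
    (hF₂ : IsMF k₁ ψ₁ F₂) (hG : IsMF k₂ ψ₂ G) (hG0 : G ≠ 0) {h₁ h₂ : LaurentSeries ℂ}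
    (e₁ : qExpansionL F₁ = h₁ * qExpansionL G) (e₂ : qExpansionL F₂ = h₂ * qExpansionL G)
    (hT : IsHeckeT ℓ c h₁ h₂) {z : ℂ} (hz : 0 < z.im) :
    ∀ᶠ u in 𝓝[≠] z, ℓ * ratioFun F₂ G u =
      ∑ j ∈ Finset.range ℓ, ratioFun F₁ G ((u + j) / ℓ) + ℓ * c * ratioFun F₁ G (ℓ * u) := by
  have hℓ' : (0 : ℝ) < ℓ := by exact_mod_cast hℓ
  obtain ⟨A₁, hA₁⟩ := (atImInfty_mem _).1 (hasSum_modularRatio hF₁ hG hG0 e₁)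
  obtain ⟨A₂, hA₂⟩ := (atImInfty_mem _).1 (hasSum_modularRatio hF₂ hG hG0 e₂)
  set B := max (max A₁ A₂) 0 with hB
  have hB0 : 0 ≤ B := le_max_right _ _
  have h1 : ∀ u : ℂ, B < u.im →
      HasSum (fun n : ℤ => h₁.coeff n * Periodic.qParam 1 u ^ n) (ratioFun F₁ G u) := by
    intro u hu
    have hu0 : 0 < u.im := hB0.trans_lt hu
    have := hA₁ ⟨u, hu0⟩ (((le_max_left _ _).trans (le_max_left _ _)).trans hu.le)
    simpa [ratioFun, ofComplex_apply_of_im_pos hu0] using this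
  have h2 : ∀ u : ℂ, B < u.im →
      HasSum (fun n : ℤ => h₂.coeff n * Periodic.qParam 1 u ^ n) (ratioFun F₂ G u) := by
    intro u hu
    have hu0 : 0 < u.im := hB0.trans_lt hu
    have := hA₂ ⟨u, hu0⟩ (((le_max_right _ _).trans (le_max_left _ _)).trans hu.le)
    simpa [ratioFun, ofComplex_apply_of_im_pos hu0] using this
  have key := eventually_eq_zero_of_meromorphic (A := ℓ * B) (D := fun u => ℓ * ratioFun F₂ G u -
      (∑ j ∈ Finset.range ℓ, ratioFun F₁ G ((u + j) / ℓ) + ℓ * c * ratioFun F₁ G (ℓ * u)))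
      ?_ ?_ hz
  · filter_upwards [key] with u hu using sub_eq_zero.1 hu
  · intro u hu
    have m1 := meromorphicAt_ratioFun hF₂.holo hG.holo hu
    have m2 := meromorphicAt_ratioFun_comp hF₁.holo hG.holo (φ := fun u => ℓ * u) (z := u)
      (by fun_prop) (by rw [im_natCast_mul]; positivity)
    have m3 : ∀ j ∈ Finset.range ℓ,
        MeromorphicAt (fun u => ratioFun F₁ G ((u + j) / ℓ)) u := fun j _ =>
      meromorphicAt_ratioFun_comp hF₁.holo hG.holo (φ := fun u => (u + j) / ℓ)
        (by fun_prop (disch := exact_mod_cast hℓ.ne')) (by rw [im_add_div]; positivity)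
    have m4 := MeromorphicAt.fun_sum m3
    exact ((MeromorphicAt.const _ _).mul m1).sub (m4.add ((MeromorphicAt.const _ _).mul m2))
  · intro u hu
    have hBu : B < u.im / ℓ := by rwa [lt_div_iff₀' hℓ']
    have h1l : (1 : ℝ) ≤ ℓ := by exact_mod_cast hℓ
    rw [sub_eq_zero]
    refine hecke_identity_of_hasSum hℓ hT (h2 u ?_) (h1 _ ?_) fun j _ => h1 _ ?_
    · nlinarith
    · rw [im_natCast_mul]; nlinarith [mul_nonneg (sub_nonneg.2 h1l) hB0]
    · rwa [im_add_div]

lemma isBigO_one_comp_of_continuousAt {H : ℂ → ℂ} {φ : ℂ → ℂ} (hinj : Injective φ) {z : ℂ}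
    (hφ : ContinuousAt φ z) (h : H =O[𝓝[≠] (φ z)] (1 : ℂ → ℝ)) :
    (fun u => H (φ u)) =O[𝓝[≠] z] (1 : ℂ → ℝ) :=
  h.comp_tendsto (hφ.continuousWithinAt.tendsto_nhdsWithin fun _ hu hu' => hu (hinj hu'))

lemma isBigO_ratioFun_of_ne_zero (hF : MDiff F) (hG : MDiff G) {z : ℂ} (hz : 0 < z.im)
    (hGz : G (ofComplex z) ≠ 0) : ratioFun F G =O[𝓝[≠] z] (1 : ℂ → ℝ) := by
  have : ContinuousAt (ratioFun F G) z :=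
    (analyticAt_comp_ofComplex hF hz).continuousAt.div
      (analyticAt_comp_ofComplex hG hz).continuousAt hGz
  exact (this.isBigO_one ℝ).mono nhdsWithin_le_nhds

lemma isBigO_one_of_eventually_mul_eq {c : ℂ} (hc : c ≠ 0) {A B : ℂ → ℂ} {l : Filter ℂ}
    (h : ∀ᶠ u in l, c * A u = B u) (hB : B =O[l] (1 : ℂ → ℝ)) : A =O[l] (1 : ℂ → ℝ) := by
  have h1 : (fun u => c * A u) =O[l] (1 : ℂ → ℝ) := hB.congr' (h.mono fun u hu => hu.symm) .rfl
  exact (isBigO_const_mul_left_iff hc).1 h1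

/-- Ratios with a common denominator, permuted by a Hecke relation, have no poles in the upper
half-plane. -/
lemma isBigO_ratioFun_of_hecke {ι : Type*} {V : Set ι} {F : ι → ℍ → ℂ} {ℓ : ℕ} (hℓ : ℓ.Prime)
    {c : ℂ} (hc : c ≠ 0) (hF : ∀ h ∈ V, MDiff (F h))
    (hFp : ∀ h ∈ V, Periodic (F h ∘ ofComplex) (1 : ℝ))
    (hG : MDiff G) (hGp : Periodic (G ∘ ofComplex) (1 : ℝ)) {T : Set ℍ} (hT : T.Finite)
    (hzeros : ∀ τ, G τ = 0 → ∃ γ : SL(2, ℤ), ∃ τ' ∈ T, γ • τ' = τ)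
    (hecke : ∀ h ∈ V, ∃ g ∈ V, ∀ z : ℂ, 0 < z.im → ∀ᶠ u in 𝓝[≠] z, ℓ * ratioFun (F g) G u =
      ∑ j ∈ Finset.range ℓ, ratioFun (F h) G ((u + j) / ℓ) + c * ratioFun (F h) G (ℓ * u)) :
    ∀ h ∈ V, ∀ z : ℂ, 0 < z.im → ratioFun (F h) G =O[𝓝[≠] z] (1 : ℂ → ℝ) := by
  have : Fact ℓ.Prime := ⟨hℓ⟩
  have hℓ0 : (ℓ : ℂ) ≠ 0 := by exact_mod_cast hℓ.ne_zero
  have hℓr : (0 : ℝ) < ℓ := by exact_mod_cast hℓ.pos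
  set S : Set ℂ := {z | 0 < z.im ∧ ∃ h ∈ V, ¬ ratioFun (F h) G =O[𝓝[≠] z] (1 : ℂ → ℝ)} with hS
  suffices hSe : ¬ S.Nonempty by
    intro h hh z hz
    by_contra hbad
    exact hSe ⟨z, hz, h, hh, hbad⟩
  intro hne
  have hreg : ∀ z : ℂ, 0 < z.im → z ∉ S → ∀ h ∈ V, ratioFun (F h) G =O[𝓝[≠] z] (1 : ℂ → ℝ) := by
    intro z hz hzS h hh
    by_contra hbad
    exact hzS ⟨hz, h, hh, hbad⟩
  have htrans : ∀ z ∈ S, ∀ j : ℤ, z + j ∈ S := by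
    rintro z ⟨hz, h, hh, hbad⟩ j
    refine ⟨by simpa using hz, h, hh, fun hgood => hbad ?_⟩
    have := isBigO_one_comp_of_continuousAt (φ := fun u => u + j) (add_left_injective _)
      (by fun_prop) hgood
    simpa only [ratioFun_add_int (hFp h hh) hGp j] using this
  have hST : ∀ τ : ℍ, (τ : ℂ) ∈ S → ∃ γ : SL(2, ℤ), ∃ τ' ∈ T, γ • τ' = τ := by
    rintro τ ⟨hz, h, hh, hbad⟩
    refine hzeros τ (by_contra fun h0 => hbad ?_)
    exact isBigO_ratioFun_of_ne_zero (hF h hh) hG hz (by rwa [ofComplex_apply])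
  have hdiv : ∀ j : ℂ, Injective fun u : ℂ => (u + j) / ℓ := fun j x y hxy => by
    simpa [div_left_inj' hℓ0] using hxy
  have hmul : Injective fun u : ℂ => (ℓ : ℂ) * u := mul_right_injective₀ hℓ0
  have hdivc : ∀ (j u : ℂ), ContinuousAt (fun u : ℂ => (u + j) / ℓ) u := fun j u => by
    fun_prop (disch := assumption)
  obtain ⟨z, ⟨hz, h, hh, hbad⟩, hcase⟩ :=
    exists_isolated_neighbour (ℓ := ℓ) hne (fun z hz => hz.1) htrans hT hST
  apply hbad
  obtain ⟨g, hg, hid⟩ := hecke h hh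
  rcases hcase with ⟨h1, h2, h3⟩ | ⟨h1, h2⟩
  · have him : 0 < ((ℓ : ℂ) * z).im := by rw [im_natCast_mul]; positivity
    have r1 := hreg _ him h1 g hg
    have r2 : (fun u => ratioFun (F h) G (ℓ * u)) =O[𝓝[≠] (ℓ * z)] (1 : ℂ → ℝ) :=
      isBigO_one_comp_of_continuousAt hmul (by fun_prop)
        (hreg _ (by rw [im_natCast_mul]; positivity) h2 h hh)
    have r3 : (fun u => ∑ j ∈ (Finset.range ℓ).erase 0, ratioFun (F h) G ((u + j) / ℓ))
        =O[𝓝[≠] (ℓ * z)] (1 : ℂ → ℝ) := by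
      refine IsBigO.fun_sum fun j hj => ?_
      rw [Finset.mem_erase, Finset.mem_range] at hj
      refine isBigO_one_comp_of_continuousAt (hdiv j) (hdivc _ _) ?_
      refine hreg _ (by rw [im_add_div]; positivity) ?_ h hh
      have := h3 j (Nat.pos_of_ne_zero hj.1) hj.2
      rwa [show ((ℓ : ℂ) * z + j) / ℓ = z + j / ℓ by field_simp]
    have r4 : (fun u => ratioFun (F h) G (u / ℓ)) =O[𝓝[≠] (ℓ * z)] (1 : ℂ → ℝ) := by
      refine isBigO_one_of_eventually_mul_eq one_ne_zero ?_
        (((r1.const_mul_left (ℓ : ℂ)).sub r3).sub (r2.const_mul_left c))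
      filter_upwards [hid _ him] with u hu
      rw [hu, ← Finset.add_sum_erase _ _ (Finset.mem_range.2 hℓ.pos)]
      simp
      ring
    have r5 := isBigO_one_comp_of_continuousAt (H := fun u => ratioFun (F h) G (u / ℓ))
      (z := z) hmul (by fun_prop) r4
    simpa [mul_div_cancel_left₀ _ hℓ0] using r5
  · have him : 0 < (z / ℓ).im := by rw [Complex.div_natCast_im]; positivity
    have r1 := hreg _ him h1 g hg
    have r3 : (fun u => ∑ j ∈ Finset.range ℓ, ratioFun (F h) G ((u + j) / ℓ))
        =O[𝓝[≠] (z / ℓ)] (1 : ℂ → ℝ) := by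
      refine IsBigO.fun_sum fun j hj => ?_
      rw [Finset.mem_range] at hj
      refine isBigO_one_comp_of_continuousAt (hdiv j) (hdivc _ _) ?_
      exact hreg _ (by rw [im_add_div]; positivity) (h2 j hj) h hh
    have r4 : (fun u => ratioFun (F h) G (ℓ * u)) =O[𝓝[≠] (z / ℓ)] (1 : ℂ → ℝ) := by
      refine isBigO_one_of_eventually_mul_eq hc ?_ ((r1.const_mul_left (ℓ : ℂ)).sub r3)
      filter_upwards [hid _ him] with u hu
      rw [hu]; ring
    have r4' : (fun u => ratioFun (F h) G (ℓ * u)) =O[𝓝[≠] ((z + 0) / ℓ)] (1 : ℂ → ℝ) := by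
      rwa [add_zero]
    have r5 := isBigO_one_comp_of_continuousAt (z := z) (hdiv 0) (hdivc 0 z) r4'
    simpa [mul_div_cancel₀ _ hℓ0] using r5

/-- A quotient of holomorphic functions without poles is holomorphic. -/
lemma exists_mdiff_of_isBigO (hF : MDiff F) (hG : MDiff G) (hG0 : G ≠ 0)
    (hb : ∀ z : ℂ, 0 < z.im → ratioFun F G =O[𝓝[≠] z] (1 : ℂ → ℝ)) :
    ∃ f : ℍ → ℂ, MDiff f ∧ f * G = F ∧
      ∀ z : ℂ, 0 < z.im → ratioFun F G =ᶠ[𝓝[≠] z] f ∘ ofComplex := by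
  set U : Set ℂ := {z | 0 < z.im}
  have hU : IsOpen U := isOpen_upperHalfPlaneSet
  have hm : MeromorphicOn (ratioFun F G) U := fun z hz => meromorphicAt_ratioFun hF hG hz
  set t := toMeromorphicNFOn (ratioFun F G) U with ht
  have hnf : MeromorphicNFOn t U := meromorphicNFOn_toMeromorphicNFOn _ _
  have hta : ∀ z ∈ U, AnalyticAt ℂ t z := by
    intro z hz
    rw [← (hnf hz).meromorphicOrderAt_nonneg_iff_analyticAt, ht,
      meromorphicOrderAt_toMeromorphicNFOn hm hz]
    by_contra! hlt
    have h1 := tendsto_norm_cobounded_atTop.comp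
      ((tendsto_cobounded_iff_meromorphicOrderAt_neg (hm z hz)).2 hlt)
    obtain ⟨C, hC⟩ := (hb z hz).bound
    obtain ⟨u, hu1, hu2⟩ := ((h1.eventually_gt_atTop C).and hC).exists
    simp at hu1 hu2
    linarith
  have heq : ∀ z ∈ U, ratioFun F G =ᶠ[𝓝[≠] z] t := fun z hz =>
    (hm.toMeromorphicNFOn_eq_self_on_nhdsNE hz).symm
  have hfc : ∀ z ∈ U, (fun τ : ℍ => t τ) ∘ ofComplex =ᶠ[𝓝 z] t := fun z hz => by
    filter_upwards [hU.mem_nhds hz] with u hu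
    simp [ofComplex_apply_of_im_pos hu]
  refine ⟨fun τ => t τ, ?_, ?_, fun z hz =>
    (heq z hz).trans ((hfc z hz).symm.filter_mono nhdsWithin_le_nhds)⟩
  · rw [UpperHalfPlane.mdifferentiable_iff]
    intro z hz
    exact ((hta z hz).differentiableAt.congr_of_eventuallyEq (hfc z hz)).differentiableWithinAt
  · ext τ
    have hτ : (τ : ℂ) ∈ U := τ.im_pos
    have hGne : ∀ᶠ u in 𝓝[≠] (τ : ℂ), (G ∘ ofComplex) u ≠ 0 := by
      rcases (analyticAt_comp_ofComplex hG hτ).eventually_eq_zero_or_eventually_ne_zero with h | h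
      · exfalso
        apply hG0
        have hcont : Tendsto (fun τ' : ℍ => (τ' : ℂ)) (𝓝 τ) (𝓝 (τ : ℂ)) :=
          UpperHalfPlane.continuous_coe.continuousAt
        apply UpperHalfPlane.eq_zero_of_frequently hG (τ := τ)
        apply Eventually.frequently
        apply eventually_nhdsWithin_of_eventually_nhds
        filter_upwards [hcont.eventually h] with τ' h'
        simpa using h'
      · exact h
    have h1 : (fun u => t u * (G ∘ ofComplex) u) =ᶠ[𝓝[≠] (τ : ℂ)] F ∘ ofComplex := by
      filter_upwards [heq _ hτ, hGne] with u h1 h2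
      rw [← h1, ratioFun, div_mul_cancel₀ _ h2]
    have c1 : ContinuousAt (fun u => t u * (G ∘ ofComplex) u) τ :=
      (hta _ hτ).continuousAt.mul (analyticAt_comp_ofComplex hG hτ).continuousAt
    have c2 := (analyticAt_comp_ofComplex hF hτ).continuousAt
    have := tendsto_nhds_unique_of_eventuallyEq (c1.tendsto.mono_left nhdsWithin_le_nhds)
      (c2.tendsto.mono_left nhdsWithin_le_nhds) h1
    simpa using this

/-- The function `|f(τ)| Im(τ)^{k/2}`. -/
def weightedNorm (k : ℤ) (f : ℍ → ℂ) (τ : ℍ) : ℝ := ‖f τ‖ * τ.im ^ ((k : ℝ) / 2)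

lemma weightedNorm_nonneg (k : ℤ) (f : ℍ → ℂ) (τ : ℍ) : 0 ≤ weightedNorm k f τ :=
  mul_nonneg (norm_nonneg _) (Real.rpow_nonneg τ.im_pos.le _)

lemma weightedNorm_smul (γ : SL(2, ℤ)) (τ : ℍ) :
    weightedNorm k f (γ • τ) = weightedNorm k (f ∣[k] γ) τ := by
  have hd : 0 < ‖denom γ τ‖ := norm_pos_iff.2 (denom_ne_zero _ τ)
  have e : (‖denom γ τ‖ ^ 2) ^ ((k : ℝ) / 2) = ‖denom γ τ‖ ^ k := by
    rw [← Real.rpow_natCast, ← Real.rpow_mul hd.le, ← Real.rpow_intCast]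
    congr 1
    push_cast
    ring
  rw [weightedNorm, weightedNorm, ModularForm.SL_slash_apply, ModularGroup.im_smul_eq_div_normSq,
    Real.div_rpow τ.im_pos.le (Complex.normSq_nonneg _), Complex.normSq_eq_norm_sq, e, norm_mul,
    norm_zpow, zpow_neg]
  ring

lemma weightedNorm_mul_smul (hf : HasNeben k ψ f) {δ : SL(2, ℤ)} (hδ : δ ∈ Gamma0 N) (τ : ℍ) :
    weightedNorm k f (δ • τ) = weightedNorm k f τ := by
  rw [weightedNorm_smul, hf δ hδ, weightedNorm, weightedNorm, Pi.smul_apply, norm_smul,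
    norm_character ψ hδ, one_mul]

lemma tendsto_ofComplex_add_div {ℓ : ℕ} (hℓ : 0 < ℓ) (i : ℤ) :
    Tendsto (fun τ : ℍ => ofComplex ((τ + i) / ℓ)) atImInfty atImInfty := by
  refine tendsto_comap_im_ofComplex.comp (tendsto_comap_iff.2 ?_)
  have : (Complex.im ∘ fun τ : ℍ => ((τ : ℂ) + i) / ℓ) = fun τ : ℍ => τ.im / ℓ := by
    ext τ
    simp [Complex.div_natCast_im]
  rw [this]
  exact tendsto_comap.atTop_div_const (by exact_mod_cast hℓ)

lemma im_ofComplex_add_div {ℓ : ℕ} (hℓ : 0 < ℓ) (i : ℤ) (τ : ℍ) :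
    (ofComplex (((τ : ℂ) + i) / ℓ)).im = τ.im / ℓ := by
  have : (((τ : ℂ) + i) / ℓ).im = τ.im / ℓ := by simp [Complex.div_natCast_im]
  have hp : 0 < (((τ : ℂ) + i) / ℓ).im := by
    rw [this]; exact div_pos τ.im_pos (by exact_mod_cast hℓ)
  rw [ofComplex_apply_of_im_pos hp]
  exact this

/-- An integral matrix of determinant `ℓ` with coprime first column is the product of an element
of `SL(2, ℤ)` with a matrix `(1 i; 0 ℓ)`. -/
lemma exists_smul_ofComplex_eq {ℓ : ℕ} (hℓ : 0 < ℓ) {A B C D : ℤ} (hdet : A * D - B * C = ℓ)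
    (hAC : IsCoprime A C) : ∃ γ : SL(2, ℤ), ∃ i : ℤ, ∀ τ : ℍ, ∀ z : ℂ,
      z * (C * τ + D) = A * τ + B → ofComplex z = γ • ofComplex ((τ + i) / ℓ) := by
  obtain ⟨v, u, huv⟩ := hAC
  have hℓ0 : (ℓ : ℂ) ≠ 0 := by exact_mod_cast hℓ.ne'
  refine ⟨⟨!![A, -u; C, v], by rw [Matrix.det_fin_two_of]; linarith⟩, v * B + u * D, ?_⟩
  intro τ z hz
  set i : ℤ := v * B + u * D
  set σ := ofComplex (((τ : ℂ) + i) / ℓ) with hσ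
  set γ : SL(2, ℤ) := ⟨!![A, -u; C, v], _⟩
  have hp : 0 < (((τ : ℂ) + i) / ℓ).im := by
    have : (((τ : ℂ) + i) / ℓ).im = τ.im / ℓ := by simp [Complex.div_natCast_im]
    rw [this]; exact div_pos τ.im_pos (by exact_mod_cast hℓ)
  have hσc : (σ : ℂ) * ℓ = τ + i := by
    rw [hσ, ofComplex_apply_of_im_pos hp]
    simp [hℓ0]
  have h1 : ((γ • σ : ℍ) : ℂ) * (C * σ + v) = A * σ + (-u : ℤ) := coe_smul_mul_denom γ σ
  have hdet' : (A : ℂ) * D - B * C = ℓ := by exact_mod_cast hdet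
  have huv' : (v : ℂ) * A + u * C = 1 := by exact_mod_cast huv
  have hi : (i : ℂ) = v * B + u * D := by simp [i]
  have h2 : ((γ • σ : ℍ) : ℂ) * (C * τ + D) = A * τ + B := by
    have e1 : (C : ℂ) * τ + D = ℓ * (C * σ + v) := by
      linear_combination (-(C : ℂ)) * hσc - (C : ℂ) * hi + v * hdet' - D * huv'
    have e2 : (A : ℂ) * τ + B = ℓ * (A * σ + (-u : ℤ)) := by
      push_cast
      linear_combination (-(A : ℂ)) * hσc - (A : ℂ) * hi - u * hdet' - B * huv'
    rw [e1, e2, ← h1]; ring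
  have hne : (C : ℂ) * τ + D ≠ 0 := by
    intro h0
    obtain ⟨hC, hD⟩ := int_combo_eq_zero τ.im_pos h0
    simp [hC, hD] at hdet
    omega
  have : z = (γ • σ : ℍ) := mul_right_cancel₀ hne (hz.trans h2.symm)
  rw [this, ofComplex_apply]

/-- The functions `f h`, `h ∈ V`, grow at most like `exp (M Im τ)` at all cusps. -/
def CuspGrowth {ι : Type*} (k : ℤ) (V : Set ι) (f : ι → ℍ → ℂ) (M : ℝ) : Prop :=
  ∀ h ∈ V, ∀ γ : SL(2, ℤ),
    (fun τ : ℍ => weightedNorm k (f h) (γ • τ)) =O[atImInfty] fun τ => Real.exp (M * τ.im)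

lemma CuspGrowth.comp_ofComplex {ι : Type*} {V : Set ι} {f : ι → ℍ → ℂ} {M : ℝ} (hM : 0 ≤ M)
    (hP : CuspGrowth k V f M) {ℓ : ℕ} (hℓ : 0 < ℓ) {h : ι} (hh : h ∈ V) {A B C D : ℤ}
    (hdet : A * D - B * C = ℓ) (hAC : IsCoprime A C) {z : ℍ → ℂ}
    (hz : ∀ τ : ℍ, z τ * (C * τ + D) = A * τ + B) :
    (fun τ : ℍ => weightedNorm k (f h) (ofComplex (z τ))) =O[atImInfty]
      fun τ => Real.exp (M * τ.im) := by
  obtain ⟨γ, i, hγ⟩ := exists_smul_ofComplex_eq hℓ hdet hAC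
  simp only [fun τ => hγ τ (z τ) (hz τ)]
  refine ((hP h hh γ).comp_tendsto (tendsto_ofComplex_add_div hℓ i)).trans ?_
  refine IsBigO.of_bound 1 (Eventually.of_forall fun τ => ?_)
  simp only [comp_apply, im_ofComplex_add_div hℓ, Real.norm_eq_abs, Real.abs_exp, one_mul]
  gcongr
  exact div_le_self τ.im_pos.le (by exact_mod_cast hℓ)

lemma weightedNorm_ofComplex (f : ℍ → ℂ) {z : ℂ} (hz : 0 < z.im) :
    weightedNorm k f (ofComplex z) = ‖(f ∘ ofComplex) z‖ * z.im ^ ((k : ℝ) / 2) := by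
  rw [weightedNorm, comp_apply, ofComplex_apply_of_im_pos hz]
  rfl

/-- The Hecke relation bounds `h` at `z / ℓ` in terms of values at other points. -/
lemma weightedNorm_le_of_hecke {ℓ : ℕ} (hℓ : 0 < ℓ) {c z : ℂ} (hz : 0 < z.im)
    (hid : ℓ * (g ∘ ofComplex) z =
      ∑ j ∈ Finset.range ℓ, (f ∘ ofComplex) ((z + j) / ℓ) + c * (f ∘ ofComplex) (ℓ * z)) :
    weightedNorm k f (ofComplex (z / ℓ)) ≤
      ℓ / (ℓ : ℝ) ^ ((k : ℝ) / 2) * weightedNorm k g (ofComplex z) +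
      ∑ j ∈ (Finset.range ℓ).erase 0, weightedNorm k f (ofComplex ((z + j) / ℓ)) +
      ‖c‖ / ((ℓ : ℝ) ^ ((k : ℝ) / 2)) ^ 2 * weightedNorm k f (ofComplex (ℓ * z)) := by
  have hℓr : (0 : ℝ) < ℓ := by exact_mod_cast hℓ
  have hp : ∀ j : ℕ, 0 < ((z + j) / (ℓ : ℂ)).im := fun j => by rw [im_add_div]; positivity
  have hp0 : 0 < (z / (ℓ : ℂ)).im := by simpa using hp 0
  have hpm : 0 < ((ℓ : ℂ) * z).im := by rw [im_natCast_mul]; positivity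
  set K := (ℓ : ℝ) ^ ((k : ℝ) / 2) with hK
  have hKp : 0 < K := Real.rpow_pos_of_pos hℓr _
  set y := (z.im / ℓ) ^ ((k : ℝ) / 2) with hy
  have hyp : 0 ≤ y := Real.rpow_nonneg (by positivity) _
  have hzy : z.im ^ ((k : ℝ) / 2) = K * y := by
    rw [hK, hy, ← Real.mul_rpow hℓr.le (by positivity), mul_div_cancel₀ _ hℓr.ne']
  have hzy2 : (ℓ * z.im) ^ ((k : ℝ) / 2) = K * (K * y) := by
    rw [Real.mul_rpow hℓr.le hz.le, hzy]
  have h0 : (z / (ℓ : ℂ)).im = z.im / ℓ := by simp [Complex.div_natCast_im]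
  rw [weightedNorm_ofComplex f hp0, weightedNorm_ofComplex g hz, weightedNorm_ofComplex f hpm,
    Finset.sum_congr rfl fun j _ => weightedNorm_ofComplex f (hp j)]
  simp only [im_add_div, im_natCast_mul, h0, hzy, hzy2, ← hy, ← Finset.sum_mul]
  have key : ‖(f ∘ ofComplex) (z / ℓ)‖ ≤ ℓ * ‖(g ∘ ofComplex) z‖ +
      ∑ j ∈ (Finset.range ℓ).erase 0, ‖(f ∘ ofComplex) ((z + j) / ℓ)‖ +
      ‖c‖ * ‖(f ∘ ofComplex) (ℓ * z)‖ := by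
    rw [← Finset.add_sum_erase _ _ (Finset.mem_range.2 hℓ)] at hid
    have e : (f ∘ ofComplex) (z / ℓ) = ℓ * (g ∘ ofComplex) z -
        ∑ j ∈ (Finset.range ℓ).erase 0, (f ∘ ofComplex) ((z + j) / ℓ) -
        c * (f ∘ ofComplex) (ℓ * z) := by
      rw [hid]; simp only [Nat.cast_zero, add_zero]; ring
    rw [e]
    refine (norm_sub_le _ _).trans (add_le_add ((norm_sub_le _ _).trans
      (add_le_add ?_ (norm_sum_le _ _))) ?_)
    · simp
    · simp
  calc _ ≤ _ := mul_le_mul_of_nonneg_right key hyp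
    _ = _ := by field_simp

/-- Every element of `SL(2, ℤ)` can be moved by `Γ₀(N)` and translations to one whose lower right
entry is divisible by `ℓ`. -/
lemma exists_normalized {ℓ : ℕ} (hℓ : ℓ.Prime) (hℓN : ¬ ℓ ∣ N) (γ : SL(2, ℤ)) :
    ∃ δ ∈ Gamma0 N, ∃ t : SL(2, ℤ), t 1 0 = 0 ∧ t 1 1 = 1 ∧
      ¬ (ℓ : ℤ) ∣ (δ * γ * t) 1 0 ∧ (ℓ : ℤ) ∣ (δ * γ * t) 1 1 := by
  have hp : Prime (ℓ : ℤ) := Nat.prime_iff_prime_int.1 hℓ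
  have hN : ¬ (ℓ : ℤ) ∣ N := by exact_mod_cast hℓN
  obtain ⟨δ, hδ, hδγ⟩ : ∃ δ ∈ Gamma0 N, ¬ (ℓ : ℤ) ∣ (δ * γ) 1 0 := by
    by_cases hc : (ℓ : ℤ) ∣ γ 1 0
    · obtain ⟨s, hs0, hs1⟩ : ∃ s : SL(2, ℤ), s 1 0 = N ∧ s 1 1 = 1 :=
        ⟨⟨!![1, 0; N, 1], by simp⟩, rfl, rfl⟩
      refine ⟨s, by simp [Gamma0_mem, hs0], ?_⟩
      have ha : ¬ (ℓ : ℤ) ∣ γ 0 0 := by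
        intro ha
        have hd := γ.det_coe
        rw [Matrix.det_fin_two] at hd
        exact hp.not_dvd_one (hd ▸ dvd_sub (ha.mul_right _) (hc.mul_left _))
      have e : (s * γ) 1 0 = N * γ 0 0 + γ 1 0 := by
        rw [Matrix.SpecialLinearGroup.coe_mul, Matrix.mul_apply, Fin.sum_univ_two, hs0, hs1,
          one_mul]
      rw [e, dvd_add_left hc, hp.dvd_mul]
      exact not_or.2 ⟨hN, ha⟩
    · exact ⟨1, one_mem _, by simpa using hc⟩
  have hcop : IsCoprime ((δ * γ) 1 0) (ℓ : ℤ) := ((hp.coprime_iff_not_dvd).2 hδγ).symm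
  obtain ⟨u, v, huv⟩ := hcop
  obtain ⟨t, h00, h01, h10, h11⟩ := exists_translation (-(u * (δ * γ) 1 1))
  refine ⟨δ, hδ, t, h10, h11, ?_, ?_⟩
  · have e : (δ * γ * t) 1 0 = (δ * γ) 1 0 := by
      rw [Matrix.SpecialLinearGroup.coe_mul, Matrix.mul_apply, Fin.sum_univ_two, h00, h10]
      simp
    rwa [e]
  · have e : (δ * γ * t) 1 1 = (δ * γ) 1 0 * (-(u * (δ * γ) 1 1)) + (δ * γ) 1 1 := by
      rw [Matrix.SpecialLinearGroup.coe_mul, Matrix.mul_apply, Fin.sum_univ_two, h01, h11]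
      simp
    rw [e]
    exact ⟨v * (δ * γ) 1 1, by linear_combination (-(δ * γ) 1 1) * huv⟩

lemma im_smul_of_unipotent {t : SL(2, ℤ)} (h10 : t 1 0 = 0) (h11 : t 1 1 = 1) (τ : ℍ) :
    (t • τ).im = τ.im := by
  rw [ModularGroup.im_smul_eq_div_normSq]
  simp [denom, h10, h11]

lemma tendsto_smul_of_unipotent {t : SL(2, ℤ)} (h10 : t 1 0 = 0) (h11 : t 1 1 = 1) :
    Tendsto (fun τ : ℍ => t • τ) atImInfty atImInfty := by
  refine tendsto_comap_iff.2 ?_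
  have : (im ∘ fun τ : ℍ => t • τ) = im := funext (im_smul_of_unipotent h10 h11)
  rw [this]
  exact tendsto_comap

/-- The Hecke relation improves any growth estimate at the cusps. -/
lemma CuspGrowth.div {ι : Type*} {V : Set ι} {f : ι → ℍ → ℂ} {M : ℝ} (hM : 0 ≤ M)
    (hP : CuspGrowth k V f M) {ℓ : ℕ} (hℓ : ℓ.Prime) (hℓN : ¬ ℓ ∣ N) {c : ℂ}
    (hf : ∀ h ∈ V, HasNeben k χ (f h))
    (hecke : ∀ h ∈ V, ∃ g ∈ V, ∀ z : ℂ, 0 < z.im → ℓ * (f g ∘ ofComplex) z =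
      ∑ j ∈ Finset.range ℓ, (f h ∘ ofComplex) ((z + j) / ℓ) + c * (f h ∘ ofComplex) (ℓ * z)) :
    CuspGrowth k V f (M / ℓ) := by
  intro h hh γ₀
  have hℓ0 : (ℓ : ℂ) ≠ 0 := by exact_mod_cast hℓ.ne_zero
  have hp : Prime (ℓ : ℤ) := Nat.prime_iff_prime_int.1 hℓ
  obtain ⟨δ, hδ, t, ht0, ht1, hc, e, he⟩ := exists_normalized hℓ hℓN γ₀
  set γ₁ := δ * γ₀ * t with hγ₁
  suffices key : (fun τ : ℍ => weightedNorm k (f h) (γ₁ • τ)) =O[atImInfty]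
      fun τ => Real.exp (M / ℓ * τ.im) by
    have ht0' : t⁻¹ 1 0 = 0 := by
      simp [Matrix.SpecialLinearGroup.coe_inv, Matrix.adjugate_fin_two, ht0]
    have ht1' : t⁻¹ 1 1 = 1 := by
      have hd := t.det_coe
      rw [Matrix.det_fin_two, ht0, ht1] at hd
      simpa [Matrix.SpecialLinearGroup.coe_inv, Matrix.adjugate_fin_two] using hd
    refine (key.comp_tendsto (tendsto_smul_of_unipotent ht0' ht1')).congr (fun τ => ?_)
      fun τ => ?_
    · simp only [comp_apply, hγ₁, mul_smul, smul_inv_smul]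
      exact weightedNorm_mul_smul (hf h hh) hδ _
    · simp only [comp_apply, im_smul_of_unipotent ht0' ht1']
  have hdet₁ := γ₁.det_coe
  rw [Matrix.det_fin_two] at hdet₁
  generalize hA : γ₁ 0 0 = A at *
  generalize hB : γ₁ 0 1 = B at *
  generalize hC : γ₁ 1 0 = C at *
  generalize hD : γ₁ 1 1 = D at *
  subst he
  set γ : SL(2, ℤ) := ⟨!![ℓ * A, B; C, e], by rw [Matrix.det_fin_two_of]; linarith⟩ with hγ
  have hz : ∀ τ : ℍ, ((γ • τ : ℍ) : ℂ) * (C * τ + e) = ((ℓ * A : ℤ) : ℂ) * τ + B :=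
    fun τ => coe_smul_mul_denom γ τ
  push_cast at hz
  have hCℓ : IsCoprime (ℓ : ℤ) C := (hp.coprime_iff_not_dvd).2 hc
  have hAC : IsCoprime A C := ⟨ℓ * e, -B, by linarith⟩
  obtain ⟨g, hg, hid⟩ := hecke h hh
  have main : (fun τ : ℍ => weightedNorm k (f h) (ofComplex ((γ • τ : ℍ) / ℓ))) =O[atImInfty]
      fun τ => Real.exp (M * τ.im) := by
    have b1 : (fun τ : ℍ => weightedNorm k (f g) (ofComplex (γ • τ : ℍ))) =O[atImInfty]
        fun τ => Real.exp (M * τ.im) := by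
      simpa only [ofComplex_apply] using hP g hg γ
    have b2 : (fun τ : ℍ => ∑ j ∈ (Finset.range ℓ).erase 0,
        weightedNorm k (f h) (ofComplex (((γ • τ : ℍ) + j) / ℓ))) =O[atImInfty]
        fun τ => Real.exp (M * τ.im) := by
      refine IsBigO.fun_sum fun j hj => ?_
      rw [Finset.mem_erase, Finset.mem_range] at hj
      have hjℓ : ¬ (ℓ : ℤ) ∣ j := by
        intro hd
        exact absurd (Nat.le_of_dvd (Nat.pos_of_ne_zero hj.1) (by exact_mod_cast hd)) (by omega)
      refine hP.comp_ofComplex hM hℓ.pos hh (A := ℓ * A + j * C) (B := B + j * e)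
        (C := ℓ * C) (D := ℓ * e) (by linear_combination (ℓ : ℤ) * hdet₁) ?_ fun τ => ?_
      · refine IsCoprime.mul_right ?_ ?_
        · have : IsCoprime (j * C : ℤ) ℓ := IsCoprime.mul_left
            ((hp.coprime_iff_not_dvd).2 hjℓ).symm hCℓ.symm
          rw [add_comm]
          exact IsCoprime.add_mul_left_left this A
        · exact IsCoprime.add_mul_right_left (IsCoprime.mul_left hCℓ hAC) j
      · push_cast
        field_simp
        linear_combination hz τ
    have b3 : (fun τ : ℍ => weightedNorm k (f h) (ofComplex (ℓ * (γ • τ : ℍ)))) =O[atImInfty]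
        fun τ => Real.exp (M * τ.im) := by
      refine hP.comp_ofComplex hM hℓ.pos hh (A := ℓ * (ℓ * A)) (B := ℓ * B) (C := C) (D := e)
        (by linear_combination (ℓ : ℤ) * hdet₁)
        (IsCoprime.mul_left hCℓ (IsCoprime.mul_left hCℓ hAC)) fun τ => ?_
      push_cast
      linear_combination (ℓ : ℂ) * hz τ
    refine IsBigO.trans (IsBigO.of_bound 1 (Eventually.of_forall fun τ => ?_))
      (((b1.const_mul_left (ℓ / (ℓ : ℝ) ^ ((k : ℝ) / 2))).add b2).add
        (b3.const_mul_left (‖c‖ / ((ℓ : ℝ) ^ ((k : ℝ) / 2)) ^ 2)))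
    rw [one_mul, Real.norm_of_nonneg (weightedNorm_nonneg _ _ _)]
    exact (weightedNorm_le_of_hecke hℓ.pos (γ • τ : ℍ).im_pos (hid _ (γ • τ : ℍ).im_pos)).trans
      (le_abs_self _)
  refine (main.comp_tendsto (tendsto_ofComplex_add_div hℓ.pos 0)).congr (fun τ => ?_) fun τ => ?_
  · simp only [comp_apply]
    set σ := ofComplex (((τ : ℂ) + (0 : ℤ)) / ℓ) with hσ
    have hτp : 0 < (((τ : ℂ) + (0 : ℤ)) / ℓ).im := by
      simpa [Complex.div_natCast_im] using div_pos τ.im_pos (Nat.cast_pos.2 hℓ.pos)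
    have hσc : (σ : ℂ) * ℓ = τ := by
      rw [hσ, ofComplex_apply_of_im_pos hτp]
      simp [hℓ0]
    congr 1
    have h1 := hz σ
    have h2 := coe_smul_mul_denom γ₁ τ
    rw [hA, hB, hC, hD] at h2
    have hne : (C : ℂ) * σ + e ≠ 0 := by
      intro h0
      obtain ⟨hC0, -⟩ := int_combo_eq_zero σ.im_pos h0
      exact hc (hC0 ▸ dvd_zero _)
    have : ((γ • σ : ℍ) : ℂ) / ℓ = (γ₁ • τ : ℍ) := by
      refine mul_right_cancel₀ (mul_ne_zero hℓ0 hne) ?_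
      push_cast at h2
      rw [← hσc] at h2
      have e1 : ((γ • σ : ℍ) : ℂ) / ℓ * (ℓ * (C * σ + e)) = (γ • σ : ℍ) * (C * σ + e) := by
        field_simp
      rw [e1]
      linear_combination h1 - h2
    rw [this, ofComplex_apply]
  · simp only [comp_apply, im_ofComplex_add_div hℓ.pos]
    congr 1
    ring

lemma tendsto_im_atImInfty : Tendsto (fun τ : ℍ => τ.im) atImInfty atTop := tendsto_comap

lemma rpow_im_isBigO (s : ℝ) {ε : ℝ} (hε : 0 < ε) :
    (fun τ : ℍ => τ.im ^ s) =O[atImInfty] fun τ => Real.exp (ε * τ.im) :=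
  ((isLittleO_rpow_exp_pos_mul_atTop s hε).comp_tendsto tendsto_im_atImInfty).isBigO

/-- The order of vanishing of a modular form is bounded uniformly over all cusps. -/
lemma IsMF.exists_exp_isBigO_slash [NeZero N] (hf : IsMF k ψ f) (h0 : f ≠ 0) :
    ∃ M : ℝ, 0 ≤ M ∧
      ∀ γ : SL(2, ℤ), (fun τ : ℍ => Real.exp (-M * τ.im)) =O[atImInfty] (f ∣[k] γ) := by
  obtain ⟨R, hR, hcos⟩ := exists_finite_coset_representatives N
  choose M hM using hf.exp_isBigO_slash h0
  obtain ⟨B, hB⟩ := (hR.image M).bddAbove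
  refine ⟨max B 0, le_max_right _ _, fun γ => ?_⟩
  obtain ⟨δ, hδ, r, hr, rfl⟩ := hcos γ
  rw [hf.neben.slash_mul hδ]
  refine IsBigO.trans ?_ ((hM r).trans (IsBigO.of_bound 1 (Eventually.of_forall fun τ => ?_)))
  · refine IsBigO.of_bound 1 (Eventually.of_forall fun τ => ?_)
    simp only [Real.norm_eq_abs, Real.abs_exp, one_mul]
    have hMB : M r ≤ max B 0 := (hB (Set.mem_image_of_mem M hr)).trans (le_max_left _ _)
    have := τ.im_pos
    gcongr
  · rw [Pi.smul_apply, norm_smul, norm_character ψ hδ, one_mul, one_mul]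

/-- Quotients with a common denominator have uniformly moderate growth at the cusps. -/
lemma exists_cuspGrowth [NeZero N] {ι : Type*} {V : Set ι} {f F : ι → ℍ → ℂ}
    (hG : IsMF w ψ G) (hG0 : G ≠ 0) (hF : ∀ h ∈ V, IsMF (w + k) (χ * ψ) (F h))
    (hfG : ∀ h ∈ V, f h * G = F h) : ∃ M : ℝ, 0 ≤ M ∧ CuspGrowth k V f M := by
  obtain ⟨M, hM0, hM⟩ := hG.exists_exp_isBigO_slash hG0
  refine ⟨M + 1, by linarith, fun h hh γ => ?_⟩
  simp only [weightedNorm_smul]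
  have h1 : (f h ∣[k] γ) * (G ∣[w] γ) = F h ∣[w + k] γ := by
    rw [← ModularForm.mul_slash_SL2, hfG h hh, add_comm]
  have h2 : (f h ∣[k] γ) =O[atImInfty] fun τ => Real.exp (M * τ.im) := by
    have h3 : (fun τ : ℍ => ‖(f h ∣[k] γ) τ‖ * Real.exp (-M * τ.im)) =O[atImInfty]
        (1 : ℍ → ℝ) := by
      refine ((isBigO_refl (fun τ => ‖(f h ∣[k] γ) τ‖) atImInfty).mul (hM γ).norm_right).trans ?_
      refine IsBigO.trans (IsBigO.of_bound 1 (Eventually.of_forall fun τ => ?_))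
        ((hF h hh).bdd γ)
      rw [← h1]
      simp
    have h4 := h3.mul (isBigO_refl (fun τ : ℍ => Real.exp (M * τ.im)) atImInfty)
    refine IsBigO.of_norm_left (h4.congr (fun τ => ?_) fun τ => ?_)
    · rw [mul_assoc, ← Real.exp_add]; simp
    · simp
  refine (h2.norm_left.mul (rpow_im_isBigO ((k : ℝ) / 2) one_pos)).congr (fun τ => rfl)
    fun τ => ?_
  rw [← Real.exp_add]; ring_nf

lemma isBoundedAtImInfty_of_exp {h ε : ℝ} (hh : 0 < h) (hε : ε * h < 2 * Real.pi)
    (hper : Periodic (f ∘ ofComplex) h) (hf : MDiff f)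
    (hb : f =O[atImInfty] fun τ => Real.exp (ε * τ.im)) : IsBoundedAtImInfty f := by
  set E : ℍ → ℂ := fun τ => Complex.exp (2 * Real.pi * Complex.I * τ / h) with hE
  have hEn : ∀ τ : ℍ, ‖E τ‖ = Real.exp (-2 * Real.pi * τ.im / h) := by
    intro τ
    rw [hE, Complex.norm_exp]
    congr 1
    rw [Complex.div_ofReal_re]
    simp
  have hEd : MDiff E := by
    rw [UpperHalfPlane.mdifferentiable_iff]
    have : DifferentiableOn ℂ (fun z : ℂ => Complex.exp (2 * Real.pi * Complex.I * z / h))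
        {z | 0 < z.im} := by fun_prop
    refine this.congr fun z hz => ?_
    simp [hE, ofComplex_apply_of_im_pos hz]
  have hEp : Periodic (E ∘ ofComplex) h := by
    refine periodic_comp_ofComplex fun τ => ?_
    rw [hE]
    simp only [coe_vadd]
    rw [Complex.exp_eq_exp_iff_exists_int]
    refine ⟨1, ?_⟩
    have : (h : ℂ) ≠ 0 := by exact_mod_cast hh.ne'
    field_simp
    push_cast
    ring
  have hfE : (f * E) =O[atImInfty] fun τ => Real.exp (-((2 * Real.pi / h - ε) * τ.im)) := by
    refine (hb.mul (isBigO_refl E atImInfty).norm_right).congr_right fun τ => ?_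
    rw [hEn, ← Real.exp_add]
    congr 1
    ring
  have hzero : IsZeroAtImInfty (f * E) := by
    refine hfE.trans_tendsto (Real.tendsto_exp_neg_atTop_nhds_zero.comp ?_)
    refine tendsto_im_atImInfty.const_mul_atTop ?_
    rw [sub_pos, lt_div_iff₀ hh]; exact hε
  have hdec := hzero.exp_decay_atImInfty hh (hper.mul hEp) (hf.mul hEd) hzero.isBoundedAtImInfty
  have h2 := hdec.norm_left.mul
    (isBigO_refl (fun τ : ℍ => Real.exp (2 * Real.pi * τ.im / h)) atImInfty)
  refine (h2.congr (fun τ => ?_) fun τ => ?_).of_norm_left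
  · rw [Pi.mul_apply, norm_mul, hEn, mul_assoc, ← Real.exp_add]
    ring_nf
    simp
  · rw [← Real.exp_add]
    ring_nf
    simp

/-- Functions with arbitrarily slow exponential growth at the cusps are bounded at the cusps. -/
lemma CuspGrowth.isBoundedAtImInfty [NeZero N] {ι : Type*} {V : Set ι} {f : ι → ℍ → ℂ} {M : ℝ}
    {ℓ : ℕ} (hℓ : 1 < ℓ) (hP : ∀ n : ℕ, CuspGrowth k V f (M / ℓ ^ n)) {h : ι} (hh : h ∈ V)
    (hf : HasNeben k χ (f h)) (hd : MDiff (f h)) (γ : SL(2, ℤ)) :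
    IsBoundedAtImInfty (f h ∣[k] γ) := by
  have hN : (0 : ℝ) < N := by exact_mod_cast NeZero.pos N
  have hlim : Tendsto (fun n : ℕ => M / (ℓ : ℝ) ^ n) atTop (𝓝 0) :=
    tendsto_const_nhds.div_atTop (tendsto_pow_atTop_atTop_of_one_lt (by exact_mod_cast hℓ))
  obtain ⟨n, hn⟩ := (hlim.eventually (gt_mem_nhds (show 0 < 1 / (N : ℝ) by positivity))).exists
  refine isBoundedAtImInfty_of_exp (ε := M / ℓ ^ n + 1 / N) hN ?_
    (periodic_comp_ofComplex (hf.slash_vadd γ)) (mdifferentiable_slash hd k γ) ?_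
  · have : (M / (ℓ : ℝ) ^ n + 1 / N) * N < (1 / N + 1 / N) * N := by gcongr
    rw [← add_div, div_mul_cancel₀ _ hN.ne'] at this
    linarith [Real.pi_gt_three]
  · have h1 := hP n h hh γ
    simp only [weightedNorm_smul] at h1
    refine ((h1.mul (rpow_im_isBigO (-((k : ℝ) / 2)) (show 0 < 1 / (N : ℝ) by positivity))).congr
      (fun τ => ?_) fun τ => ?_).of_norm_left
    · rw [weightedNorm, mul_assoc, ← Real.rpow_add τ.im_pos, add_neg_cancel, Real.rpow_zero,
        mul_one]
    · rw [← Real.exp_add]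
      ring_nf

lemma hasNeben_of_mul_eq (hG : HasNeben w ψ G) (hGd : MDiff G) (hG0 : G ≠ 0) (hfd : MDiff f)
    (hF : HasNeben (w + k) (χ * ψ) (f * G)) : HasNeben k χ f := by
  intro γ hγ
  have h1 := hF γ hγ
  rw [add_comm, ModularForm.mul_slash_SL2, hG γ hγ] at h1
  have hψ := character_ne_zero ψ hγ
  have h2 : (f ∣[k] γ - χ ((γ 1 1 : ℤ) : ZMod N) • f) * G = 0 := by
    ext τ
    have := congrFun h1 τ
    simp only [Pi.mul_apply, Pi.smul_apply, smul_eq_mul, MulChar.mul_apply] at this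
    refine mul_left_cancel₀ hψ ?_
    simp only [Pi.mul_apply, Pi.sub_apply, Pi.smul_apply, smul_eq_mul, Pi.zero_apply]
    linear_combination this
  rcases (UpperHalfPlane.mul_eq_zero_iff
    ((mdifferentiable_slash hfd k γ).sub (hfd.const_smul _)) hGd).1 h2 with h | h
  · exact sub_eq_zero.1 h
  · exact absurd h hG0

/-- The Hecke relation passes from the quotients to their holomorphic extensions. -/
lemma hecke_identity_of_eventuallyEq {ℓ : ℕ} (hℓ : 0 < ℓ) {c : ℂ} {r₁ r₂ : ℂ → ℂ}
    (hf : MDiff f) (hg : MDiff g) (h₁ : ∀ z : ℂ, 0 < z.im → r₁ =ᶠ[𝓝[≠] z] f ∘ ofComplex)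
    (h₂ : ∀ z : ℂ, 0 < z.im → r₂ =ᶠ[𝓝[≠] z] g ∘ ofComplex) {z : ℂ} (hz : 0 < z.im)
    (h : ∀ᶠ u in 𝓝[≠] z,
      ℓ * r₂ u = ∑ j ∈ Finset.range ℓ, r₁ ((u + j) / ℓ) + c * r₁ (ℓ * u)) :
    ℓ * (g ∘ ofComplex) z =
      ∑ j ∈ Finset.range ℓ, (f ∘ ofComplex) ((z + j) / ℓ) + c * (f ∘ ofComplex) (ℓ * z) := by
  have hℓ0 : (ℓ : ℂ) ≠ 0 := by exact_mod_cast hℓ.ne'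
  have hℓr : (0 : ℝ) < ℓ := by exact_mod_cast hℓ
  have hp : ∀ j : ℕ, 0 < ((z + j) / (ℓ : ℂ)).im := fun j => by rw [im_add_div]; positivity
  have hpm : 0 < ((ℓ : ℂ) * z).im := by rw [im_natCast_mul]; positivity
  have hdc : ∀ j : ℕ, ContinuousAt (fun u : ℂ => (u + j) / ℓ) z := fun j => by
    fun_prop (disch := assumption)
  have hmc : ContinuousAt (fun u : ℂ => (ℓ : ℂ) * u) z := by fun_prop
  have punct : ∀ {φ : ℂ → ℂ}, Injective φ → ContinuousAt φ z →
      Tendsto φ (𝓝[≠] z) (𝓝[≠] (φ z)) := fun hinj hφ =>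
    hφ.continuousWithinAt.tendsto_nhdsWithin fun _ hu hu' => hu (hinj hu')
  have e1 : ∀ j : ℕ, ∀ᶠ u in 𝓝[≠] z, r₁ ((u + j) / ℓ) = (f ∘ ofComplex) ((u + j) / ℓ) := fun j =>
    (punct (fun x y hxy => by simpa [div_left_inj' hℓ0] using hxy) (hdc j)).eventually
      (h₁ _ (hp j))
  have e2 : ∀ᶠ u in 𝓝[≠] z, r₁ (ℓ * u) = (f ∘ ofComplex) (ℓ * u) :=
    (punct (mul_right_injective₀ hℓ0) hmc).eventually (h₁ _ hpm)
  have e1' : ∀ᶠ u in 𝓝[≠] z, ∀ j ∈ Finset.range ℓ,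
      r₁ ((u + j) / ℓ) = (f ∘ ofComplex) ((u + j) / ℓ) :=
    (Finset.eventually_all _).2 fun j _ => e1 j
  have key : (fun u => ℓ * (g ∘ ofComplex) u) =ᶠ[𝓝[≠] z] fun u =>
      ∑ j ∈ Finset.range ℓ, (f ∘ ofComplex) ((u + j) / ℓ) + c * (f ∘ ofComplex) (ℓ * u) := by
    filter_upwards [h, h₂ z hz, e1', e2] with u hu hu2 hu1 hum
    rw [← hu2, hu, hum, Finset.sum_congr rfl hu1]
  have cont : ∀ {f' : ℍ → ℂ} {x : ℂ}, MDiff f' → 0 < x.im → ContinuousAt (f' ∘ ofComplex) x :=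
    fun hf' hx => (analyticAt_comp_ofComplex hf' hx).continuousAt
  have c1 : ContinuousAt (fun u => ℓ * (g ∘ ofComplex) u) z :=
    continuousAt_const.mul (cont hg hz)
  have c2 : ContinuousAt (fun u => ∑ j ∈ Finset.range ℓ, (f ∘ ofComplex) ((u + j) / ℓ) +
      c * (f ∘ ofComplex) (ℓ * u)) z := by
    refine ContinuousAt.add (tendsto_finsetSum _ fun j _ => ?_)
      (continuousAt_const.mul ?_)
    · exact ContinuousAt.comp (g := f ∘ ofComplex) (f := fun u : ℂ => (u + j) / ℓ)
        (cont hf (hp j)) (hdc j)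
    · exact ContinuousAt.comp (g := f ∘ ofComplex) (f := fun u : ℂ => ℓ * u)
        (cont hf hpm) hmc
  exact tendsto_nhds_unique_of_eventuallyEq (c1.tendsto.mono_left nhdsWithin_le_nhds)
    (c2.tendsto.mono_left nhdsWithin_le_nhds) key

end HeckeStability

/-- Hecke stability in characteristic zero: if `V` is a finite-dimensional subspace of
`ℂ((q))` consisting of weight-`k`, character-`χ` modular ratios for level `N ≥ 1`, and `V` is
stable under the Hecke operator `T = T_ℓ` on `q`-expansions (whose coefficient formula involves
the scalar `χ(ℓ)·ℓ^{k-1}`) for a prime `ℓ ∤ N`, then every element of `V` is the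
`q`-expansion of a modular form of weight `k`, level `N` and nebentypus `χ`. -/
theorem hecke_stability_char_zero (N : ℕ) (hN : 1 ≤ N) (k : ℤ)
    (χ : DirichletCharacter ℂ N) (ℓ : ℕ) (hℓ : ℓ.Prime) (hℓN : ¬ ℓ ∣ N)
    (V : Submodule ℂ (LaurentSeries ℂ)) (hfin : FiniteDimensional ℂ V)
    (hratio : ∀ h ∈ V, IsModularRatio N k χ h)
    (hstab : ∀ h ∈ V, ∃ g ∈ V,
      IsHeckeT ℓ (χ ((ℓ : ZMod N)) * (ℓ : ℂ) ^ (k - 1)) h g) :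
    ∀ h ∈ V, ∃ F : ModularForm (Gamma1 N) k,
      HasNeben k χ ⇑F ∧ h = qExpansionL ⇑F := by
  have : NeZero N := ⟨by omega⟩
  have hℓ0 : (ℓ : ℂ) ≠ 0 := by exact_mod_cast hℓ.ne_zero
  set c := χ ((ℓ : ZMod N)) * (ℓ : ℂ) ^ (k - 1) with hc
  have hc0 : c ≠ 0 := by
    refine mul_ne_zero (IsUnit.map χ ?_).ne_zero (zpow_ne_zero _ hℓ0)
    exact (ZMod.isUnit_iff_coprime ℓ N).2 ((hℓ.coprime_iff_not_dvd).2 hℓN)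
  obtain ⟨w, ψ, G, hG, hG0, hV⟩ :=
    exists_common_denominator (Module.Finite.iff_fg.1 hfin) hratio
  have hV' : ∀ h : LaurentSeries ℂ, ∃ F : ℍ → ℂ, h ∈ V →
      IsMF (w + k) (χ * ψ) F ∧ qExpansionL F = h * qExpansionL G := fun h => by
    by_cases hh : h ∈ V
    · obtain ⟨F, hF⟩ := hV h hh
      exact ⟨F, fun _ => hF⟩
    · exact ⟨0, fun h' => absurd h' hh⟩
  choose F hF using hV'
  have hecke : ∀ h ∈ (V : Set (LaurentSeries ℂ)), ∃ g ∈ (V : Set (LaurentSeries ℂ)),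
      ∀ z : ℂ, 0 < z.im → ∀ᶠ u in nhdsWithin z {z}ᶜ, ℓ * ratioFun (F g) G u =
        ∑ j ∈ Finset.range ℓ, ratioFun (F h) G ((u + j) / ℓ) +
          ℓ * c * ratioFun (F h) G (ℓ * u) := by
    intro h hh
    obtain ⟨g, hg, hT⟩ := hstab h hh
    exact ⟨g, hg, fun z hz => hecke_identity hℓ.pos (hF h hh).1 (hF g hg).1 hG hG0 (hF h hh).2
      (hF g hg).2 hT hz⟩
  obtain ⟨T, hT, hzeros⟩ := hG.zeros_finite hG0
  have hreg := isBigO_ratioFun_of_hecke hℓ (mul_ne_zero hℓ0 hc0) (fun h hh => (hF h hh).1.holo)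
    (fun h hh => (hF h hh).1.periodic) hG.holo hG.periodic hT hzeros hecke
  have hext : ∀ h : LaurentSeries ℂ, ∃ f : ℍ → ℂ, h ∈ V →
      MDifferentiable (modelWithCornersSelf ℂ ℂ) (modelWithCornersSelf ℂ ℂ) f ∧ f * G = F h ∧
      ∀ z : ℂ, 0 < z.im → ratioFun (F h) G =ᶠ[nhdsWithin z {z}ᶜ] f ∘ ofComplex := fun h => by
    by_cases hh : h ∈ V
    · obtain ⟨f, hf⟩ := exists_mdiff_of_isBigO (hF h hh).1.holo hG.holo hG0 (hreg h hh)
      exact ⟨f, fun _ => hf⟩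
    · exact ⟨0, fun h' => absurd h' hh⟩
  choose f hf using hext
  have hneben : ∀ h ∈ V, HasNeben k χ (f h) := fun h hh =>
    hasNeben_of_mul_eq hG.neben hG.holo hG0 (hf h hh).1 ((hf h hh).2.1 ▸ (hF h hh).1.neben)
  have hecke' : ∀ h ∈ (V : Set (LaurentSeries ℂ)), ∃ g ∈ (V : Set (LaurentSeries ℂ)),
      ∀ z : ℂ, 0 < z.im → ℓ * (f g ∘ ofComplex) z =
        ∑ j ∈ Finset.range ℓ, (f h ∘ ofComplex) ((z + j) / ℓ) +
          ℓ * c * (f h ∘ ofComplex) (ℓ * z) := by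
    intro h hh
    obtain ⟨g, hg, hid⟩ := hecke h hh
    exact ⟨g, hg, fun z hz => hecke_identity_of_eventuallyEq hℓ.pos (hf h hh).1 (hf g hg).1
      (hf h hh).2.2 (hf g hg).2.2 hz (hid z hz)⟩
  obtain ⟨M, hM, hP⟩ := exists_cuspGrowth (V := (V : Set (LaurentSeries ℂ))) hG hG0
    (fun h hh => (hF h hh).1) fun h hh => (hf h hh).2.1
  have hPn : ∀ n : ℕ, CuspGrowth k (V : Set (LaurentSeries ℂ)) f (M / ℓ ^ n) := by
    intro n
    induction n with
    | zero => simpa using hP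
    | succ n ih =>
      rw [pow_succ, ← div_div]
      exact ih.div (by positivity) hℓ hℓN hneben hecke'
  intro h hh
  have hmf : IsMF k χ (f h) := ⟨(hf h hh).1, hneben h hh, fun γ =>
    CuspGrowth.isBoundedAtImInfty hℓ.one_lt hPn hh (hneben h hh) (hf h hh).1 γ⟩
  obtain ⟨Φ, hΦ⟩ := hmf.exists_modularForm
  refine ⟨Φ, hΦ ▸ hneben h hh, ?_⟩
  rw [hΦ]
  refine mul_right_cancel₀ (mt hG.qExpansionL_eq_zero_iff.1 hG0) ?_
  rw [← (hF h hh).2, ← hmf.qExpansionL_mul hG, (hf h hh).2.1]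

end
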